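/- arXiv:2512.23799 — 7 statements merged into one kernel-verified Lean document; each statement's English description precedes it below -/
import Mathlib

section
/- A unitary U on n qubits is a Clifford whose square lies in the Pauli group P_n if and only if U can be written as U = α · P · exp((πi/4) Σ_{j=1}^m Q_j) for some integer m ≥ 0, a Pauli operator P ∈ P_n, pairwise commuting Hermitian Pauli operators Q_1,…,Q_m ∈ P_n, and a complex number α with α^8 = 1. -/
open Matrix Complex

noncomputable section

/-- An `n`-qubit operator: a matrix indexed by binary strings of length `n`. -/
abbrev QOp (n : ℕ) := Matrix (Fin n → Fin 2) (Fin n → Fin 2) ℂ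

/-- The single-qubit Pauli `X` matrix. -/
def PauliX : Matrix (Fin 2) (Fin 2) ℂ := !![0, 1; 1, 0]

/-- The single-qubit Pauli `Y` matrix. -/
def PauliY : Matrix (Fin 2) (Fin 2) ℂ := !![0, -Complex.I; Complex.I, 0]

/-- The single-qubit Pauli `Z` matrix. -/
def PauliZ : Matrix (Fin 2) (Fin 2) ℂ := !![1, 0; 0, -1]

/-- The tensor product of single-qubit operators, one per qubit. -/
def tensorOp {n : ℕ} (σ : Fin n → Matrix (Fin 2) (Fin 2) ℂ) : QOp n :=
  fun x y => ∏ i, σ i (x i) (y i)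

/-- A matrix is unitary. -/
def IsUnitary {m : Type*} [Fintype m] [DecidableEq m] (U : Matrix m m ℂ) : Prop :=
  U * Uᴴ = 1 ∧ Uᴴ * U = 1

/-- Membership in the `n`-qubit Pauli group: a phase in `{1, -1, i, -i}` times a
tensor product of single-qubit Pauli matrices (including the identity). -/
def IsPauli {n : ℕ} (P : QOp n) : Prop :=
  ∃ (γ : ℂ) (σ : Fin n → Matrix (Fin 2) (Fin 2) ℂ),
    (γ = 1 ∨ γ = -1 ∨ γ = Complex.I ∨ γ = -Complex.I) ∧
    (∀ i, σ i = 1 ∨ σ i = PauliX ∨ σ i = PauliY ∨ σ i = PauliZ) ∧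
    P = γ • tensorOp σ

/-- An `n`-qubit Clifford unitary: conjugation preserves the Pauli group. -/
def IsClifford {n : ℕ} (U : QOp n) : Prop :=
  IsUnitary U ∧ ∀ P : QOp n, IsPauli P → IsPauli (U * P * Uᴴ)

/-- The Clifford hierarchy: level 1 is the Pauli group; for `k ≥ 2`, level `k`
consists of the unitaries conjugating every Pauli into level `k - 1`. -/
def CliffordLevel {n : ℕ} : ℕ → QOp n → Prop
  | 0, _ => False
  | 1, V => IsPauli V
  | (k+2), V => IsUnitary V ∧ ∀ P : QOp n, IsPauli P → CliffordLevel (k+1) (V * P * Vᴴ)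

/-- The controlled gate `C(U) = |0⟩⟨0| ⊗ I + |1⟩⟨1| ⊗ U`, with the control on qubit `0`. -/
def controlled {n : ℕ} (U : QOp n) : QOp (n+1) :=
  fun x y =>
    if x 0 = y 0 then
      (if x 0 = 0 then (if Fin.tail x = Fin.tail y then 1 else 0)
       else U (Fin.tail x) (Fin.tail y))
    else 0

/-- The tensor product `a ⊗ A` of a single-qubit operator `a` (on the control qubit `0`)
with an `n`-qubit operator `A` (on the register). -/
def tensorWith {n : ℕ} (a : Matrix (Fin 2) (Fin 2) ℂ) (A : QOp n) : QOp (n+1) :=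
  fun x y => a (x 0) (y 0) * A (Fin.tail x) (Fin.tail y)

/-- `A` acts trivially on qubit `i`: it is block-diagonal in the qubit-`i` basis and its
entries do not depend on the (common) value of the `i`-th coordinate. -/
def actsTriviallyOn {n : ℕ} (A : QOp n) (i : Fin n) : Prop :=
  (∀ x y, x i ≠ y i → A x y = 0) ∧
  (∀ x y (c c' : Fin 2),
    A (Function.update x i c) (Function.update y i c) =
      A (Function.update x i c') (Function.update y i c'))

/-- The support of an operator: the set of qubits on which it acts nontrivially. -/
def Supp {n : ℕ} (A : QOp n) : Set (Fin n) := {i | ¬ actsTriviallyOn A i}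

/-- A Pauli-Square-Root Clifford: a non-Pauli Clifford whose square is a Pauli. -/
def IsPSC {n : ℕ} (C : QOp n) : Prop := IsClifford C ∧ ¬ IsPauli C ∧ IsPauli (C * C)

/-- Two operators either commute or anticommute. -/
def CommOrAnticomm {n : ℕ} (A B : QOp n) : Prop := A * B = B * A ∨ A * B = -(B * A)


lemma z2 (a : ZMod 2) : a = 0 ∨ a = 1 := by revert a; decide

abbrev PV (n : ℕ) := Fin n → ZMod 2 × ZMod 2

def sgn (a : ZMod 2) : ℂ := if a = 0 then 1 else -1

lemma sgn_add (a b : ZMod 2) : sgn (a+b) = sgn a * sgn b := by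
  have h11 : (1 : ZMod 2) + 1 = 0 := by decide
  rcases z2 a with rfl | rfl <;> rcases z2 b with rfl | rfl <;> simp [sgn, h11]

lemma sgn_inj {a b : ZMod 2} (h : sgn a = sgn b) : a = b := by
  rcases z2 a with rfl | rfl <;> rcases z2 b with rfl | rfl <;> simp [sgn] at h ⊢ <;> norm_num [Complex.ext_iff] at h

lemma sgn_sum {ι : Type*} (s : Finset ι) (f : ι → ZMod 2) :
    sgn (∑ i ∈ s, f i) = ∏ i ∈ s, sgn (f i) := by
  classical
  induction s using Finset.induction_on with
  | empty => simp [sgn]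
  | insert a s ha ih => rw [Finset.sum_insert ha, Finset.prod_insert ha, sgn_add, ih]

def sg (a : ZMod 2 × ZMod 2) : Matrix (Fin 2) (Fin 2) ℂ :=
  if a.1 = 0 then (if a.2 = 0 then 1 else PauliZ) else (if a.2 = 0 then PauliX else PauliY)

lemma sg_mul (a b : ZMod 2 × ZMod 2) :
    ∃ γ : ℂ, γ ^ 4 = 1 ∧ sg a * sg b = γ • sg (a + b) := by
  have key : ∃ γ : ℂ, (γ = 1 ∨ γ = Complex.I ∨ γ = -Complex.I) ∧ sg a * sg b = γ • sg (a + b) := by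
    obtain ⟨a1, a2⟩ := a
    obtain ⟨b1, b2⟩ := b
    have h11 : (1 : ZMod 2) + 1 = 0 := by decide
    rcases z2 a1 with rfl | rfl <;> rcases z2 a2 with rfl | rfl <;> rcases z2 b1 with rfl | rfl <;> rcases z2 b2 with rfl | rfl <;>
    first
    | (refine ⟨1, by simp, ?_⟩
       ext i j; fin_cases i <;> fin_cases j <;>
        simp [sg, h11, PauliX, PauliY, PauliZ, Matrix.mul_apply, Fin.sum_univ_two]; done)
    | (refine ⟨Complex.I, by simp, ?_⟩
       ext i j; fin_cases i <;> fin_cases j <;>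
        simp [sg, h11, PauliX, PauliY, PauliZ, Matrix.mul_apply, Fin.sum_univ_two]; done)
    | (refine ⟨-Complex.I, by simp, ?_⟩
       ext i j; fin_cases i <;> fin_cases j <;>
        simp [sg, h11, PauliX, PauliY, PauliZ, Matrix.mul_apply, Fin.sum_univ_two]; done)
  obtain ⟨γ, h, e⟩ := key
  refine ⟨γ, ?_, e⟩
  rcases h with rfl | rfl | rfl <;> simp [Complex.I_pow_four, Even.neg_pow (by decide : Even 4)]

lemma sg_comm (a b : ZMod 2 × ZMod 2) :
    sg a * sg b = sgn (a.1 * b.2 + a.2 * b.1) • (sg b * sg a) := by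
  obtain ⟨a1, a2⟩ := a
  obtain ⟨b1, b2⟩ := b
  have h11 : (1 : ZMod 2) + 1 = 0 := by decide
  rcases z2 a1 with rfl | rfl <;> rcases z2 a2 with rfl | rfl <;> rcases z2 b1 with rfl | rfl <;> rcases z2 b2 with rfl | rfl <;>
    (ext i j; fin_cases i <;> fin_cases j <;>
        simp [sg, sgn, h11, PauliX, PauliY, PauliZ, Matrix.mul_apply, Fin.sum_univ_two])

lemma sg_sq (a : ZMod 2 × ZMod 2) : sg a * sg a = 1 := by
  obtain ⟨a1, a2⟩ := a
  rcases z2 a1 with rfl | rfl <;> rcases z2 a2 with rfl | rfl <;>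
    (ext i j; fin_cases i <;> fin_cases j <;>
        simp [sg, PauliX, PauliY, PauliZ, Matrix.mul_apply, Fin.sum_univ_two])

lemma sg_herm (a : ZMod 2 × ZMod 2) : (sg a)ᴴ = sg a := by
  obtain ⟨a1, a2⟩ := a
  rcases z2 a1 with rfl | rfl <;> rcases z2 a2 with rfl | rfl <;>
    (ext i j; fin_cases i <;> fin_cases j <;>
        simp [sg, PauliX, PauliY, PauliZ, Matrix.conjTranspose_apply])

variable {n : ℕ}

lemma tensorOp_mul (σ τ : Fin n → Matrix (Fin 2) (Fin 2) ℂ) :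
    tensorOp σ * tensorOp τ = tensorOp (fun i => σ i * τ i) := by
  ext x y
  simp only [tensorOp, Matrix.mul_apply, ← Finset.prod_mul_distrib]
  rw [Finset.prod_univ_sum]
  simp

lemma tensorOp_smul (c : Fin n → ℂ) (σ : Fin n → Matrix (Fin 2) (Fin 2) ℂ) :
    tensorOp (fun i => c i • σ i) = (∏ i, c i) • tensorOp σ := by
  ext x y
  simp [tensorOp, Finset.prod_mul_distrib]

lemma tensorOp_one : tensorOp (fun _ : Fin n => (1 : Matrix (Fin 2) (Fin 2) ℂ)) = 1 := by
  ext x y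
  simp only [tensorOp, Matrix.one_apply, Finset.prod_ite_zero, Finset.prod_const_one]
  simp [funext_iff]

def pl (v : PV n) : QOp n := tensorOp (fun i => sg (v i))

def om (v w : PV n) : ZMod 2 := ∑ i, ((v i).1 * (w i).2 + (v i).2 * (w i).1)

lemma om_add_left (u v w : PV n) : om (u + v) w = om u w + om v w := by
  simp only [om, ← Finset.sum_add_distrib]
  refine Finset.sum_congr rfl fun i _ => ?_
  simp; ring

lemma om_comm (v w : PV n) : om v w = om w v := by
  refine Finset.sum_congr rfl fun i _ => ?_
  ring

lemma om_add_right (u v w : PV n) : om u (v + w) = om u v + om u w := by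
  rw [om_comm, om_add_left, om_comm v, om_comm w]

lemma om_self (v : PV n) : om v v = 0 := by
  refine Finset.sum_eq_zero fun i _ => ?_
  rw [mul_comm (v i).2]; exact CharTwo.add_self_eq_zero _

lemma om_zero_left (v : PV n) : om 0 v = 0 := by simp [om]
lemma om_zero_right (v : PV n) : om v 0 = 0 := by simp [om]

lemma om_rep (χ : PV n →+ ZMod 2) : ∃ w : PV n, ∀ v, om w v = χ v := by
  let w : PV n := fun i => (χ (Pi.single i (0,1)), χ (Pi.single i (1,0)))
  refine ⟨w, ?_⟩
  let ψ : PV n →+ ZMod 2 := AddMonoidHom.mk' (om w) (om_add_right w)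
  have : ψ = χ := by
    refine AddMonoidHom.functions_ext _ _ _ fun i p => ?_
    obtain ⟨a, b⟩ := p
    have h1 : ψ (Pi.single i (a,b)) = (w i).1 * b + (w i).2 * a := by
      change om w _ = _
      unfold om
      rw [Finset.sum_eq_single i]
      · simp
      · intro j _ hj; simp [hj]
      · simp
    have h2 : χ (Pi.single i (a,b)) = χ (Pi.single i (a, 0)) + χ (Pi.single i (0,b)) := by
      rw [← map_add, ← Pi.single_add]; simp
    rw [h1, h2]
    have h0 : (Pi.single i (0 : ZMod 2 × ZMod 2) : PV n) = 0 := Pi.single_zero i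
    rw [Prod.zero_eq_mk] at h0
    rcases z2 a with rfl | rfl <;> rcases z2 b with rfl | rfl <;> simp [w, h0, add_comm]
  intro v
  exact DFunLike.congr_fun this v

lemma om_nondeg (v : PV n) (h : ∀ w, om v w = 0) : v = 0 := by
  funext i
  have h1 := h (Pi.single i (1,0))
  have h2 := h (Pi.single i (0,1))
  unfold om at h1 h2
  rw [Finset.sum_eq_single i (by intro j _ hj; simp [hj]) (by simp)] at h1 h2
  simp at h1 h2
  exact Prod.ext h2 h1

lemma PV_add_self (v : PV n) : v + v = 0 := by
  funext i
  exact Prod.ext (CharTwo.add_self_eq_zero _) (CharTwo.add_self_eq_zero _)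

lemma pl_sq (v : PV n) : pl v * pl v = 1 := by
  simp only [pl, tensorOp_mul, sg_sq, tensorOp_one]

lemma pl_herm (v : PV n) : (pl v)ᴴ = pl v := by
  ext x y
  simp only [pl, tensorOp, Matrix.conjTranspose_apply, star_prod]
  refine Finset.prod_congr rfl fun i _ => ?_
  rw [← Matrix.conjTranspose_apply, sg_herm]

lemma pl_comm (v w : PV n) : pl v * pl w = sgn (om v w) • (pl w * pl v) := by
  simp only [pl, tensorOp_mul, om, sgn_sum, ← tensorOp_smul, ← sg_comm]

lemma pl_mul (v w : PV n) : ∃ γ : ℂ, γ ^ 4 = 1 ∧ pl v * pl w = γ • pl (v + w) := by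
  choose γ h1 h2 using fun i => sg_mul (v i) (w i)
  refine ⟨∏ i, γ i, by simp [← Finset.prod_pow, h1], ?_⟩
  simp only [pl, tensorOp_mul, h2, tensorOp_smul]; rfl

lemma pl_zero : pl (0 : PV n) = 1 := by
  rw [← tensorOp_one]; simp [pl, sg]

def IsP (v : PV n) (A : QOp n) : Prop := ∃ γ : ℂ, γ ^ 4 = 1 ∧ A = γ • pl v

lemma isP_pl (v : PV n) : IsP v (pl v) := ⟨1, by simp, by simp⟩

lemma IsP.mul {v w : PV n} {A B : QOp n} (hA : IsP v A) (hB : IsP w B) : IsP (v + w) (A * B) := by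
  obtain ⟨a, ha, rfl⟩ := hA
  obtain ⟨b, hb, rfl⟩ := hB
  obtain ⟨c, hc, e⟩ := pl_mul v w
  refine ⟨a * b * c, by simp [mul_pow, ha, hb, hc], ?_⟩
  rw [smul_mul_smul_comm, e, smul_smul]

lemma IsP.smul {v : PV n} {A : QOp n} (hA : IsP v A) {c : ℂ} (hc : c ^ 4 = 1) : IsP v (c • A) := by
  obtain ⟨a, ha, rfl⟩ := hA
  exact ⟨c * a, by simp [mul_pow, ha, hc], by rw [smul_smul]⟩

lemma ne_zero_of_pow4 {c : ℂ} (hc : c ^ 4 = 1) : c ≠ 0 := by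
  rintro rfl; simp at hc

lemma pl_ne (v : PV n) : pl v ≠ 0 := by
  intro h
  have := pl_sq v
  rw [h] at this
  simp at this

lemma IsP.comm {v w : PV n} {A B : QOp n} (hA : IsP v A) (hB : IsP w B) :
    A * B = sgn (om v w) • (B * A) := by
  obtain ⟨a, ha, rfl⟩ := hA
  obtain ⟨b, hb, rfl⟩ := hB
  rw [smul_mul_smul_comm, smul_mul_smul_comm, pl_comm v w, smul_comm, mul_comm a b]

lemma IsP.mul_ne {v w : PV n} {A B : QOp n} (hA : IsP v A) (hB : IsP w B) : A * B ≠ 0 := by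
  obtain ⟨c, hc, e⟩ := hA.mul hB
  rw [e]
  exact smul_ne_zero (ne_zero_of_pow4 hc) (pl_ne _)

lemma om_ext {v w : PV n} (h : ∀ u, om v u = om w u) : v = w := by
  have : v + w = 0 := om_nondeg _ fun u => by
    rw [om_add_left, h]; exact CharTwo.add_self_eq_zero _
  rw [← add_zero v, ← PV_add_self w, ← add_assoc, this, zero_add]

lemma IsP.uniq {v w : PV n} {A : QOp n} (hA : IsP v A) (hB : IsP w A) : v = w := by
  refine om_ext fun u => sgn_inj ?_
  have h1 := hA.comm (isP_pl u)
  rw [hB.comm (isP_pl u)] at h1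
  exact (smul_left_injective ℂ ((isP_pl u).mul_ne hA) h1).symm

lemma pow4_cases {γ : ℂ} (h : γ ^ 4 = 1) :
    γ = 1 ∨ γ = -1 ∨ γ = Complex.I ∨ γ = -Complex.I := by
  have : (γ - 1) * ((γ + 1) * ((γ - Complex.I) * (γ + Complex.I))) = 0 := by
    linear_combination h - (γ^2 - 1) * Complex.I_sq
  rcases mul_eq_zero.1 this with h | h
  · exact Or.inl (sub_eq_zero.1 h)
  rcases mul_eq_zero.1 h with h | h
  · exact Or.inr (Or.inl (eq_neg_of_add_eq_zero_left h))
  rcases mul_eq_zero.1 h with h | h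
  · exact Or.inr (Or.inr (Or.inl (sub_eq_zero.1 h)))
  · exact Or.inr (Or.inr (Or.inr (eq_neg_of_add_eq_zero_left h)))

lemma isPauli_iff {A : QOp n} : IsPauli A ↔ ∃ v, IsP v A := by
  constructor
  · rintro ⟨γ, σ, hγ, hσ, rfl⟩
    have : ∀ i, ∃ a, σ i = sg a := by
      intro i
      rcases hσ i with h | h | h | h
      · exact ⟨(0,0), by simp [h, sg]⟩
      · exact ⟨(1,0), by simp [h, sg]⟩
      · exact ⟨(1,1), by simp [h, sg]⟩
      · exact ⟨(0,1), by simp [h, sg]⟩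
    choose v hv using this
    refine ⟨v, γ, ?_, ?_⟩
    · rcases hγ with rfl | rfl | rfl | rfl <;>
        simp [Complex.I_pow_four, Even.neg_pow (by decide : Even 4)]
    · rw [pl]; congr; funext i; exact hv i
  · rintro ⟨v, γ, hγ, rfl⟩
    refine ⟨γ, fun i => sg (v i), pow4_cases hγ, fun i => ?_, rfl⟩
    simp only [sg]
    split_ifs <;> simp

lemma scalar_of_comm {A : QOp n} (h : ∀ v, A * pl v = pl v * A) : ∃ c : ℂ, A = c • 1 := by
  have hoff : ∀ x y, x ≠ y → A x y = 0 := by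
    intro x y hxy
    obtain ⟨i, hi⟩ := Function.ne_iff.1 hxy
    let v : PV n := Pi.single i (0,1)
    have hd : pl v = Matrix.diagonal (fun x : Fin n → Fin 2 => if x i = 0 then (1:ℂ) else -1) := by
      ext a b
      simp only [pl, tensorOp, Matrix.diagonal_apply]
      by_cases hab : a = b
      · subst hab
        rw [Finset.prod_eq_single i]
        · generalize a i = p
          fin_cases p <;> simp [v, sg, PauliZ]
        · intro j _ hj; simp [v, sg, hj]
        · simp
      · obtain ⟨j, hj⟩ := Function.ne_iff.1 hab
        rw [if_neg hab]
        refine Finset.prod_eq_zero (Finset.mem_univ j) ?_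
        by_cases hji : j = i
        · subst hji
          generalize a j = p at *; generalize b j = q at *
          fin_cases p <;> fin_cases q <;> simp [v, sg, PauliZ] at hj ⊢
        · simp [v, sg, hji, hj]
    have h1 := congrFun (congrFun (h v) x) y
    rw [hd, Matrix.mul_diagonal, Matrix.diagonal_mul] at h1
    generalize x i = p at *; generalize y i = q at *
    have h2 : ∀ z : ℂ, z = -z → z = 0 := fun z hz => by linear_combination hz / 2
    fin_cases p <;> fin_cases q <;> simp at hi h1
    · exact h2 _ h1.symm
    · exact h2 _ h1
  have hon : ∀ x y, A x x = A y y := by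
    intro x y
    let v : PV n := fun i => (if x i = y i then 0 else 1, 0)
    have hne : pl v x y = 1 := by
      simp only [pl, tensorOp]
      refine Finset.prod_eq_one fun i _ => ?_
      simp only [v]
      generalize x i = p at *; generalize y i = q at *
      fin_cases p <;> fin_cases q <;> simp [sg, PauliX]
    have h1 := congrFun (congrFun (h v) x) y
    rw [Matrix.mul_apply, Matrix.mul_apply, Finset.sum_eq_single x, Finset.sum_eq_single y, hne] at h1
    · simpa using h1
    · intro b _ hb; simp [hoff b y hb]
    · simp
    · intro b _ hb; simp [hoff x b hb.symm]
    · simp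
  refine ⟨A 0 0, ?_⟩
  ext x y
  by_cases hxy : x = y
  · subst hxy; simp [hon x 0]
  · simp [hoff x y hxy, hxy]

lemma om_smul_left (c : ZMod 2) (v w : PV n) : om (c • v) w = c * om v w := by
  rcases z2 c with rfl | rfl <;> simp [om_zero_left]

lemma om_smul_right (c : ZMod 2) (v w : PV n) : om v (c • w) = c * om v w := by
  rw [om_comm, om_smul_left, om_comm]

def tvf (p q : PV n) : PV n →ₗ[ZMod 2] PV n where
  toFun z := om z p • q
  map_add' x y := by rw [om_add_left, add_smul]
  map_smul' c x := by simp [om_smul_left, mul_smul]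

lemma tvf_apply (p q z : PV n) : tvf p q z = om z p • q := rfl

lemma split_aux (a b : ZMod 2) (z p q : PV n) :
    z + a • q + b • p + (a + b) • (p + q) + a • p + b • q = z := by
  have h2 : (2 : ZMod 2) = 0 := by decide
  funext i
  refine Prod.ext ?_ ?_
  · simp
    linear_combination (a * (q i).1 + b * (q i).1 + a * (p i).1 + b * (p i).1) * h2
  · simp
    linear_combination (a * (q i).2 + b * (q i).2 + a * (p i).2 + b * (p i).2) * h2

lemma decomp : ∀ (k : ℕ) (N : PV n →ₗ[ZMod 2] PV n),
    (∀ x y, om (N x) y = om x (N y)) → (Finset.univ.filter (fun x => N x ≠ 0)).card = k →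
    ∃ (m : ℕ) (q : Fin m → PV n), (∀ j, ∃ x, q j = N x) ∧ ∀ x, N x = ∑ j, om x (q j) • q j := by
  intro k
  induction k using Nat.strong_induction_on with
  | _ k ih =>
  intro N hs hk
  have step : ∀ N' : PV n →ₗ[ZMod 2] PV n, (∀ x y, om (N' x) y = om x (N' y)) →
      (∀ z, N z = 0 → N' z = 0) → (∃ x, N x ≠ 0 ∧ N' x = 0) → 
      ∃ (m : ℕ) (q : Fin m → PV n), (∀ j, ∃ x, q j = N' x) ∧ ∀ x, N' x = ∑ j, om x (q j) • q j := by
    intro N' hs' hz ⟨x, hx1, hx2⟩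
    refine ih _ ?_ N' hs' rfl
    rw [← hk]
    apply Finset.card_lt_card
    rw [Finset.ssubset_iff_of_subset]
    · exact ⟨x, by simpa using hx1, by simpa using hx2⟩
    · intro z; simp only [Finset.mem_filter, Finset.mem_univ, true_and]
      exact fun h h' => h (hz z h')
  by_cases h1 : ∃ x, om x (N x) ≠ 0
  · obtain ⟨x, hx⟩ := h1
    have hx1 : om x (N x) = 1 := (z2 _).resolve_left hx
    obtain ⟨m, q, hq, hN⟩ := step (N + tvf (N x) (N x)) (by
        intro a b
        simp only [LinearMap.add_apply, tvf_apply, om_add_left, om_add_right, om_smul_left,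
          om_smul_right, hs]
        rw [← hs x b, om_comm (N x) b]; ring) (by
        intro z hz
        simp [tvf_apply, hz, ← hs, om_zero_left]) ⟨x, by
          intro h; rw [h, om_zero_right] at hx1; exact zero_ne_one hx1, by
          simp [tvf_apply, hx1, PV_add_self]⟩
    refine ⟨m + 1, Fin.cons (N x) q, ?_, ?_⟩
    · intro j
      refine Fin.cases ?_ (fun j => ?_) j
      · exact ⟨x, rfl⟩
      · obtain ⟨y, hy⟩ := hq j
        refine ⟨y + om y (N x) • x, ?_⟩
        rw [Fin.cons_succ, hy]; simp [tvf_apply]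
    · intro y
      rw [Fin.sum_univ_succ]
      simp only [Fin.cons_zero, Fin.cons_succ]
      rw [← hN]
      simp only [LinearMap.add_apply, tvf_apply]
      rw [add_comm, add_assoc, PV_add_self, add_zero]
  · push Not at h1
    by_cases h2 : ∃ x, N x ≠ 0
    · obtain ⟨x, hx⟩ := h2
      have : ∃ y, om (N x) y ≠ 0 := by
        by_contra! h; exact hx (om_nondeg _ h)
      obtain ⟨y, hy⟩ := this
      have hy1 : om (N x) y = 1 := (z2 _).resolve_left hy
      obtain ⟨m, q, hq, hN⟩ := step (N + tvf (N x) (N y) + tvf (N y) (N x)) (by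
        intro a b
        simp only [LinearMap.add_apply, tvf_apply, om_add_left, om_add_right, om_smul_left,
          om_smul_right, hs]
        rw [← hs x b, ← hs y b, om_comm (N x) b, om_comm (N y) b]; ring) (by
        intro z hz
        simp [tvf_apply, hz, ← hs, om_zero_left]) ⟨x, hx, by
          simp [tvf_apply, h1, ← hs x y, hy1, PV_add_self]⟩
      refine ⟨m + 1 + 1 + 1, Fin.cons (N (x + y)) (Fin.cons (N x) (Fin.cons (N y) q)), ?_, ?_⟩
      · intro j
        refine Fin.cases ?_ (fun j => Fin.cases ?_ (fun j => Fin.cases ?_ (fun j => ?_) j) j) j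
        · exact ⟨_, rfl⟩
        · exact ⟨_, rfl⟩
        · exact ⟨_, rfl⟩
        · obtain ⟨z, hz⟩ := hq j
          refine ⟨z + om z (N x) • y + om z (N y) • x, ?_⟩
          simp only [Fin.cons_succ]
          rw [hz]; simp [tvf_apply]
      · intro z
        rw [Fin.sum_univ_succ, Fin.sum_univ_succ, Fin.sum_univ_succ]
        simp only [Fin.cons_zero, Fin.cons_succ]
        rw [← hN]
        simp only [LinearMap.add_apply, tvf_apply, map_add, om_add_right]
        conv_lhs => rw [← split_aux (om z (N x)) (om z (N y)) (N z) (N x) (N y)]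
        abel
    · push Not at h2
      exact ⟨0, Fin.elim0, fun j => j.elim0, fun x => by simp [h2]⟩

lemma exp_invol {Q : QOp n} (hQ : Q * Q = 1) (c : ℂ) :
    NormedSpace.exp (c • Q) = Complex.cosh c • (1 : QOp n) + Complex.sinh c • Q := by
  let φ : ℂ × ℂ →+* QOp n :=
    { toFun := fun a => ((a.1 + a.2) / 2) • (1 : QOp n) + ((a.1 - a.2) / 2) • Q
      map_one' := by simp
      map_zero' := by simp
      map_add' := by
        intro a b; simp only [Prod.fst_add, Prod.snd_add]; module
      map_mul' := by
        intro a b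
        simp only [Prod.fst_mul, Prod.snd_mul, mul_add, add_mul, smul_mul_smul_comm, hQ, one_mul,
          mul_one]
        module }
  have hφ : Continuous φ := by
    change Continuous fun a : ℂ × ℂ => ((a.1 + a.2) / 2) • (1 : QOp n) + ((a.1 - a.2) / 2) • Q
    fun_prop
  have h : φ (NormedSpace.exp (c, -c)) = NormedSpace.exp (φ (c, -c)) := by
    rw [NormedSpace.exp_eq_tsum ℚ, NormedSpace.exp_eq_tsum ℚ]
    refine ((NormedSpace.expSeries_summable' (𝕂 := ℚ) (c, -c)).hasSum.map φ hφ).tsum_eq.symm.trans ?_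
    dsimp only [Function.comp_def]
    simp_rw [map_inv_natCast_smul φ ℚ ℚ, map_pow]
  have h1 : φ (c, -c) = c • Q := by
    change ((c + -c) / 2) • (1 : QOp n) + ((c - -c) / 2) • Q = _
    module
  rw [h1] at h
  rw [← h]
  change (((NormedSpace.exp (c, -c)).1 + (NormedSpace.exp (c, -c)).2) / 2) • (1 : QOp n) +
    (((NormedSpace.exp (c, -c)).1 - (NormedSpace.exp (c, -c)).2) / 2) • Q = _
  rw [Prod.fst_exp, Prod.snd_exp, Complex.cosh, Complex.sinh, ← Complex.exp_eq_exp_ℂ]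

def th : ℂ := (Real.pi : ℂ) * Complex.I / 4

lemma exp_half {Q : QOp n} (hQ : Q * Q = 1) :
    NormedSpace.exp ((2 * th) • Q) = Complex.I • Q := by
  rw [exp_invol hQ]
  have : 2 * th = ((Real.pi : ℂ) / 2) * Complex.I := by unfold th; ring
  rw [this, Complex.cosh_mul_I, Complex.sinh_mul_I, Complex.cos_pi_div_two, Complex.sin_pi_div_two]
  simp

lemma exp_mul_neg (S : QOp n) : NormedSpace.exp S * NormedSpace.exp (-S) = 1 := by
  rw [← Matrix.exp_add_of_commute _ _ (Commute.neg_right (Commute.refl S))]; simp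

lemma exp_neg_mul (S : QOp n) : NormedSpace.exp (-S) * NormedSpace.exp S = 1 := by
  rw [← Matrix.exp_add_of_commute _ _ (Commute.neg_left (Commute.refl S))]; simp

lemma exp_two (S : QOp n) :
    NormedSpace.exp (th • S) * NormedSpace.exp (th • S) = NormedSpace.exp ((2 * th) • S) := by
  rw [← Matrix.exp_add_of_commute _ _ (Commute.refl _), two_mul, add_smul]

lemma exp_conj1 {q v : PV n} {Q A : QOp n} (hQ : IsP q Q) (hQ2 : Q * Q = 1) (hA : IsP v A) :
    IsP (v + om v q • q) (NormedSpace.exp (th • Q) * A * NormedSpace.exp (-(th • Q))) := by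
  have hc := hA.comm hQ
  rcases z2 (om v q) with h | h
  · rw [h] at hc ⊢
    have hc' : A * Q = Q * A := by simpa [sgn] using hc
    have : NormedSpace.exp (th • Q) * A = A * NormedSpace.exp (th • Q) := by
      rw [exp_invol hQ2]; simp [mul_add, add_mul, hc']
    rw [this, mul_assoc, exp_mul_neg]; simpa using hA
  · rw [h] at hc ⊢
    have hc' : A * Q = -(Q * A) := by simpa [sgn] using hc
    have : A * NormedSpace.exp (-(th • Q)) = NormedSpace.exp (th • Q) * A := by
      rw [← neg_smul, exp_invol hQ2, exp_invol hQ2]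
      simp [mul_add, add_mul, hc', Complex.cosh_neg, Complex.sinh_neg]
    rw [mul_assoc, this, ← mul_assoc, exp_two, exp_half hQ2, smul_mul_assoc, one_smul, add_comm]
    exact (hQ.mul hA).smul Complex.I_pow_four

lemma om_of_comm {v w : PV n} {A B : QOp n} (hA : IsP v A) (hB : IsP w B) (h : A * B = B * A) :
    om v w = 0 := by
  apply sgn_inj
  have h1 := hA.comm hB
  rw [h] at h1
  have : (1 : ℂ) • (B * A) = sgn (om v w) • (B * A) := by rw [one_smul]; exact h1
  rw [← smul_left_injective ℂ (hB.mul_ne hA) this]; simp [sgn]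

lemma exp_conjm : ∀ (m : ℕ) (q : Fin m → PV n) (Q : Fin m → QOp n), (∀ j, IsP (q j) (Q j)) →
    (∀ j, Q j * Q j = 1) → (∀ i j, Q i * Q j = Q j * Q i) → ∀ (v : PV n) (A : QOp n), IsP v A →
    IsP (v + ∑ j, om v (q j) • q j)
      (NormedSpace.exp (th • ∑ j, Q j) * A * NormedSpace.exp (-(th • ∑ j, Q j))) := by
  intro m
  induction m with
  | zero => intro q Q _ _ _ v A hA; simpa using hA
  | succ m ih =>
    intro q Q hq hQ hc v A hA
    have h1 := ih (fun j => q j.succ) (fun j => Q j.succ) (fun j => hq _) (fun j => hQ _)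
      (fun i j => hc _ _) v A hA
    have h2 := exp_conj1 (hq 0) (hQ 0) h1
    have hcm : Commute (Q 0) (∑ j : Fin m, Q j.succ) :=
      Commute.sum_right _ _ _ fun j _ => hc _ _
    have hcm2 : Commute (th • Q 0) (th • ∑ j : Fin m, Q j.succ) :=
      (hcm.smul_left _).smul_right _
    have hom : om (v + ∑ j : Fin m, om v (q j.succ) • q j.succ) (q 0) = om v (q 0) := by
      rw [om_add_left]
      have : ∀ s : Finset (Fin m), om (∑ j ∈ s, om v (q j.succ) • q j.succ) (q 0) = 0 := by
        intro s
        induction s using Finset.induction_on with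
        | empty => simp [om_zero_left]
        | insert a s ha ih =>
          rw [Finset.sum_insert ha, om_add_left, ih, om_smul_left,
            om_of_comm (hq _) (hq _) (hc a.succ 0)]; simp
      rw [this, add_zero]
    rw [hom] at h2
    rw [Fin.sum_univ_succ, Fin.sum_univ_succ, smul_add, Matrix.exp_add_of_commute _ _ hcm2,
      neg_add_rev, Matrix.exp_add_of_commute _ _ hcm2.symm.neg_left.neg_right]
    convert h2 using 1
    · abel
    · simp only [mul_assoc]

lemma exp_sqm : ∀ (m : ℕ) (q : Fin m → PV n) (Q : Fin m → QOp n), (∀ j, IsP (q j) (Q j)) →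
    (∀ j, Q j * Q j = 1) → (∀ i j, Q i * Q j = Q j * Q i) → 
    ∃ w, IsP w (NormedSpace.exp ((2 * th) • ∑ j, Q j)) := by
  intro m
  induction m with
  | zero => intro q Q _ _ _; exact ⟨0, by simpa [pl_zero] using isP_pl (0 : PV n)⟩
  | succ m ih =>
    intro q Q hq hQ hc
    obtain ⟨w, hw⟩ := ih (fun j => q j.succ) (fun j => Q j.succ) (fun j => hq _) (fun j => hQ _)
      (fun i j => hc _ _)
    have hcm : Commute (Q 0) (∑ j : Fin m, Q j.succ) :=
      Commute.sum_right _ _ _ fun j _ => hc _ _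
    refine ⟨q 0 + w, ?_⟩
    rw [Fin.sum_univ_succ, smul_add, Matrix.exp_add_of_commute _ _
      ((hcm.smul_left _).smul_right _), exp_half (hQ 0)]
    exact ((hq 0).smul Complex.I_pow_four).mul hw

lemma IsP.herm {v : PV n} {A : QOp n} (hA : IsP v A) : IsP v Aᴴ := by
  obtain ⟨a, ha, rfl⟩ := hA
  refine ⟨star a, ?_, by rw [Matrix.conjTranspose_smul, pl_herm]⟩
  rw [← star_pow, ha, star_one]

lemma mul_star_of_pow {a : ℂ} {k : ℕ} (hk : k ≠ 0) (ha : a ^ k = 1) : a * star a = 1 := by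
  have : ‖a‖ = 1 := Complex.norm_eq_one_of_pow_eq_one ha hk
  have h := Complex.mul_conj a
  rw [Complex.normSq_eq_norm_sq, this] at h
  simpa using h

lemma IsP.mul_herm {v : PV n} {A : QOp n} (hA : IsP v A) : A * Aᴴ = 1 := by
  obtain ⟨a, ha, rfl⟩ := hA
  rw [Matrix.conjTranspose_smul, pl_herm, smul_mul_smul_comm, pl_sq,
    mul_star_of_pow (by norm_num) ha, one_smul]

lemma exp_herm {S : QOp n} (hS : Sᴴ = S) :
    (NormedSpace.exp (th • S))ᴴ = NormedSpace.exp (-(th • S)) := by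
  rw [← Matrix.exp_conjTranspose, Matrix.conjTranspose_smul, hS, ← neg_smul]
  congr 2
  simp [th]
  ring

lemma core {m : ℕ} {P : QOp n} {Q : Fin m → QOp n} (hP : IsPauli P)
    (hQ : ∀ j, IsPauli (Q j) ∧ (Q j)ᴴ = Q j) (hc : ∀ i j, Q i * Q j = Q j * Q i) :
    IsPauli ((P * NormedSpace.exp (th • ∑ j, Q j)) * (P * NormedSpace.exp (th • ∑ j, Q j))) ∧
    ∀ A, IsPauli A → IsPauli ((P * NormedSpace.exp (th • ∑ j, Q j)) * A *
      (P * NormedSpace.exp (th • ∑ j, Q j))ᴴ) := by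
  have hS : (∑ j, Q j)ᴴ = ∑ j, Q j := by
    rw [Matrix.conjTranspose_sum]; exact Finset.sum_congr rfl fun j _ => (hQ j).2
  choose q hq using fun j => isPauli_iff.1 (hQ j).1
  have hQ2 : ∀ j, Q j * Q j = 1 := fun j => by
    have := (hq j).mul_herm; rwa [(hQ j).2] at this
  obtain ⟨p, hp⟩ := isPauli_iff.1 hP
  constructor
  · obtain ⟨w, hw⟩ := exp_sqm m q Q hq hQ2 hc
    have h1 := exp_conjm m q Q hq hQ2 hc p P hp
    have h2 := (hp.mul h1).mul hw
    rw [← exp_two] at h2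
    refine isPauli_iff.2 ⟨p + (p + ∑ j, om p (q j) • q j) + w, ?_⟩
    convert h2 using 1
    have h3 := exp_neg_mul (th • ∑ j, Q j)
    generalize NormedSpace.exp (th • ∑ j, Q j) = E at *
    generalize NormedSpace.exp (-(th • ∑ j, Q j)) = E' at *
    calc P * E * (P * E) = P * (E * P * 1 * E) := by simp only [mul_assoc, mul_one]
      _ = _ := by rw [← h3]; simp only [mul_assoc]
  · intro A hA
    obtain ⟨a, ha⟩ := isPauli_iff.1 hA
    have h1 := exp_conjm m q Q hq hQ2 hc a A ha
    have h2 := (hp.mul h1).mul hp.herm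
    refine isPauli_iff.2 ⟨p + (a + ∑ j, om a (q j) • q j) + p, ?_⟩
    convert h2 using 1
    rw [Matrix.conjTranspose_mul, exp_herm hS]
    simp only [mul_assoc]

lemma fixes_scalar {V : QOp n} (hV : V * Vᴴ = 1) (hV' : Vᴴ * V = 1)
    (h : ∀ v, IsP v (V * pl v * Vᴴ)) : ∃ (c : ℂ) (w : PV n), V = c • pl w := by
  have hsq : ∀ v, ∃ e : ZMod 2, V * pl v = sgn e • (pl v * V) := by
    intro v
    obtain ⟨γ, -, hγ⟩ := h v
    have h1 : V * pl v = γ • (pl v * V) := by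
      rw [← smul_mul_assoc, ← hγ, mul_assoc, hV', mul_one]
    have h2 : (V * pl v * Vᴴ) * (V * pl v * Vᴴ) = 1 := by
      calc _ = V * pl v * (Vᴴ * V) * pl v * Vᴴ := by simp only [mul_assoc]
        _ = V * (pl v * pl v) * Vᴴ := by rw [hV']; simp only [mul_assoc, one_mul]
        _ = 1 := by rw [pl_sq, mul_one, hV]
    rw [hγ, smul_mul_smul_comm, pl_sq] at h2
    have h3 : (γ * γ) • (1 : QOp n) = (1 : ℂ) • (1 : QOp n) := by rw [h2, one_smul]
    have h4 := smul_left_injective ℂ (one_ne_zero : (1 : QOp n) ≠ 0) h3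
    rcases mul_self_eq_one_iff.1 h4 with rfl | rfl
    · exact ⟨0, by simpa [sgn] using h1⟩
    · exact ⟨1, by simpa [sgn] using h1⟩
  choose χ hχ using hsq
  have hne : ∀ v, pl v * V ≠ 0 := by
    intro v hv
    have : pl v * (pl v * V) * Vᴴ = 1 := by rw [← mul_assoc, pl_sq, one_mul, hV]
    rw [hv] at this; simp at this
  have hadd : ∀ v w, χ (v + w) = χ v + χ w := by
    intro v w
    apply sgn_inj
    obtain ⟨γ, hγ, e⟩ := pl_mul v w
    have h1 : V * (pl v * pl w) = (sgn (χ v) * sgn (χ w)) • (pl v * pl w * V) := by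
      rw [← mul_assoc, hχ, smul_mul_assoc, mul_assoc, hχ, mul_smul_comm, smul_smul, mul_assoc]
    rw [e, mul_smul_comm, smul_mul_assoc, hχ, smul_comm] at h1
    have h2 := smul_left_injective ℂ (smul_ne_zero (ne_zero_of_pow4 hγ) (hne (v + w))) h1
    rw [h2, sgn_add]
  obtain ⟨w, hw⟩ := om_rep (AddMonoidHom.mk' χ hadd)
  have hw' : ∀ v, om w v = χ v := hw
  obtain ⟨c, hc⟩ := scalar_of_comm (A := pl w * V) (by
    intro v
    rw [mul_assoc, hχ, mul_smul_comm, ← mul_assoc, pl_comm w v, smul_mul_assoc, smul_smul,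
      ← sgn_add, hw', CharTwo.add_self_eq_zero, mul_assoc]
    simp [sgn])
  refine ⟨c, w, ?_⟩
  calc V = pl w * (pl w * V) := by rw [← mul_assoc, pl_sq, one_mul]
    _ = _ := by rw [hc]; simp

lemma main_forward {U : QOp n} (hC : IsClifford U) (hS : IsPauli (U * U)) :
    ∃ (m : ℕ) (P : QOp n) (Q : Fin m → QOp n) (α : ℂ),
        IsPauli P ∧
        (∀ j, IsPauli (Q j) ∧ (Q j)ᴴ = Q j) ∧
        (∀ i j, Q i * Q j = Q j * Q i) ∧
        α ^ 8 = 1 ∧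
        U = α • (P * NormedSpace.exp (th • ∑ j, Q j)) := by
  obtain ⟨⟨hU1, hU2⟩, hC⟩ := hC
  choose F hF using fun v : PV n => isPauli_iff.1 (hC (pl v) (isPauli_iff.2 ⟨v, isP_pl v⟩))
  have hF' : ∀ v A, IsP v A → IsP (F v) (U * A * Uᴴ) := by
    rintro v A ⟨a, ha, rfl⟩
    rw [mul_smul_comm, smul_mul_assoc]
    exact (hF v).smul ha
  have hmul : ∀ A B : QOp n, U * (A * B) * Uᴴ = (U * A * Uᴴ) * (U * B * Uᴴ) := by
    intro A B
    calc _ = U * A * 1 * B * Uᴴ := by simp only [mul_assoc, one_mul]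
      _ = _ := by rw [← hU2]; simp only [mul_assoc]
  have hadd : ∀ v w, F (v + w) = F v + F w := by
    intro v w
    have h1 := hF' _ _ ((isP_pl v).mul (isP_pl w))
    rw [hmul] at h1
    exact h1.uniq ((hF v).mul (hF w))
  have hFF : ∀ v, F (F v) = v := by
    intro v
    obtain ⟨t, ht⟩ := isPauli_iff.1 hS
    have h1 := hF' _ _ (hF v)
    have h2 := (ht.mul (isP_pl v)).mul ht.herm
    have e : U * (U * pl v * Uᴴ) * Uᴴ = U * U * pl v * (U * U)ᴴ := by
      rw [Matrix.conjTranspose_mul]; simp only [mul_assoc]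
    rw [e] at h1
    rw [h1.uniq h2, add_comm t v, add_assoc, PV_add_self, add_zero]
  have hom : ∀ v w, om (F v) (F w) = om v w := by
    intro v w
    apply sgn_inj
    have h1 := (hF v).comm (hF w)
    rw [← hmul, ← hmul, pl_comm v w, mul_smul_comm, smul_mul_assoc] at h1
    refine (smul_left_injective ℂ ?_ h1).symm
    rw [hmul]; exact (hF w).mul_ne (hF v)
  let Fl : PV n →ₗ[ZMod 2] PV n := (AddMonoidHom.mk' F hadd).toZModLinearMap 2
  let N : PV n →ₗ[ZMod 2] PV n := Fl + LinearMap.id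
  have hNa : ∀ v, N v = F v + v := fun v => rfl
  have hNs : ∀ x y, om (N x) y = om x (N y) := by
    intro x y
    rw [hNa, hNa, om_add_left, om_add_right, ← hom (F x) y, hFF]
  have hNN : ∀ x, N (N x) = 0 := by
    intro x
    rw [hNa, hNa, hadd, hFF, add_comm (F x) x, PV_add_self]
  obtain ⟨m, q, hq, hN⟩ := decomp _ N hNs rfl
  have hqq : ∀ i j, om (q i) (q j) = 0 := by
    intro i j
    obtain ⟨x, hx⟩ := hq i
    obtain ⟨y, hy⟩ := hq j
    rw [hx, hy, hNs, hNN, om_zero_right]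
  let Q : Fin m → QOp n := fun j => pl (q j)
  have hQP : ∀ j, IsPauli (Q j) ∧ (Q j)ᴴ = Q j := fun j =>
    ⟨isPauli_iff.2 ⟨_, isP_pl _⟩, pl_herm _⟩
  have hQc : ∀ i j, Q i * Q j = Q j * Q i := by
    intro i j
    simp only [Q]
    rw [pl_comm, hqq]; simp [sgn]
  have hQS : (∑ j, Q j)ᴴ = ∑ j, Q j := by
    rw [Matrix.conjTranspose_sum]; exact Finset.sum_congr rfl fun j _ => (hQP j).2
  have hconj := exp_conjm m q Q (fun j => isP_pl _) (fun j => pl_sq _) hQc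
  have hEh := exp_herm hQS
  have hE1 := exp_mul_neg (th • ∑ j, Q j)
  have hE2 := exp_neg_mul (th • ∑ j, Q j)
  have hcore := fun P hP => (core (P := P) hP hQP hQc).1
  suffices hs : ∃ (P : QOp n) (α : ℂ), IsPauli P ∧ α ^ 8 = 1 ∧
      U = α • (P * NormedSpace.exp (th • ∑ j, Q j)) by
    obtain ⟨P, α, h1, h2, h3⟩ := hs
    exact ⟨m, P, Q, α, h1, hQP, hQc, h2, h3⟩
  generalize NormedSpace.exp (th • ∑ j, Q j) = E at *
  generalize NormedSpace.exp (-(th • ∑ j, Q j)) = E' at *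
  have hEh' : E'ᴴ = E := by rw [← hEh, Matrix.conjTranspose_conjTranspose]
  have hinv : ∀ v, IsP (v + N v) (E' * pl v * E) := by
    intro v
    obtain ⟨γ, hγ, e⟩ := hconj (v + N v) _ (isP_pl (v + N v))
    rw [← hN, map_add, hNN, add_zero, add_assoc, PV_add_self, add_zero] at e
    have hγ0 := ne_zero_of_pow4 hγ
    refine ⟨γ⁻¹, by rw [inv_pow, hγ, inv_one], ?_⟩
    have e2 : pl v = γ⁻¹ • (E * pl (v + N v) * E') := by
      rw [e, smul_smul, inv_mul_cancel₀ hγ0, one_smul]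
    rw [e2, mul_smul_comm, smul_mul_assoc]
    congr 1
    calc E' * (E * pl (v + N v) * E') * E = (E' * E) * pl (v + N v) * (E' * E) := by
          simp only [mul_assoc]
      _ = _ := by rw [hE2, one_mul, mul_one]
  have hVh : (U * E')ᴴ = E * Uᴴ := by rw [Matrix.conjTranspose_mul, hEh']
  obtain ⟨c, w, hcw⟩ := fixes_scalar (V := U * E')
    (by
      rw [hVh]
      calc U * E' * (E * Uᴴ) = U * (E' * E) * Uᴴ := by simp only [mul_assoc]
        _ = 1 := by rw [hE2, mul_one, hU1])
    (by
      rw [hVh]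
      calc E * Uᴴ * (U * E') = E * (Uᴴ * U) * E' := by simp only [mul_assoc]
        _ = 1 := by rw [hU2, mul_one, hE1])
    (by
      intro v
      have h1 := hF' _ _ (hinv v)
      have e : F (v + N v) = v := by
        rw [hadd, hNa, hadd, hFF, add_comm v (F v), ← add_assoc, PV_add_self, zero_add]
      rw [e] at h1
      rw [hVh]
      convert h1 using 1
      simp only [mul_assoc])
  have hUE : U = c • (pl w * E) := by
    calc U = U * E' * E := by rw [mul_assoc, hE2, mul_one]
      _ = _ := by rw [hcw, smul_mul_assoc]
  refine ⟨pl w, c, isPauli_iff.2 ⟨w, isP_pl w⟩, ?_, hUE⟩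
  obtain ⟨r, hr⟩ := isPauli_iff.1 (hcore (pl w) (isPauli_iff.2 ⟨w, isP_pl w⟩))
  obtain ⟨t, a, ha, hta⟩ := isPauli_iff.1 hS
  obtain ⟨b, hb, hrb⟩ := hr
  have h1 : (c * c * b) • pl r = a • pl t := by
    rw [← hta, hUE, smul_mul_smul_comm, hrb, smul_smul]
  have hb0 := ne_zero_of_pow4 hb
  have ha0 := ne_zero_of_pow4 ha
  have hrt : r = t := by
    refine om_ext fun u => sgn_inj ?_
    have hA : IsP t (a • pl t) := ⟨a, ha, rfl⟩
    have k1 := hA.comm (isP_pl u)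
    rw [← h1, smul_mul_assoc, pl_comm r u, mul_smul_comm, smul_comm] at k1
    refine smul_left_injective ℂ ?_ k1
    rw [← mul_smul_comm, h1]
    exact (isP_pl u).mul_ne hA
  subst hrt
  have h2 : c * c * b = a := smul_left_injective ℂ (pl_ne r) h1
  have h3 : c ^ 8 * b ^ 4 = a ^ 4 := by rw [← h2]; ring
  rwa [ha, hb, mul_one] at h3

/-- A unitary `U` on `n` qubits is a Clifford whose square lies in the Pauli
group iff `U = α • P * exp((πi/4) Σ Q_j)` for a Pauli `P`, pairwise commuting Hermitian
Paulis `Q_j`, and `α` with `α^8 = 1`. -/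
theorem clifford_square_pauli_iff_normal_form {n : ℕ} (U : QOp n) (hU : IsUnitary U) :
    (IsClifford U ∧ IsPauli (U * U)) ↔
      ∃ (m : ℕ) (P : QOp n) (Q : Fin m → QOp n) (α : ℂ),
        IsPauli P ∧
        (∀ j, IsPauli (Q j) ∧ (Q j)ᴴ = Q j) ∧
        (∀ i j, Q i * Q j = Q j * Q i) ∧
        α ^ 8 = 1 ∧
        U = α • (P * NormedSpace.exp
          (((Real.pi : ℂ) * Complex.I / 4) • ∑ j, Q j)) := by
  constructor
  · rintro ⟨h1, h2⟩
    exact main_forward h1 h2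
  · rintro ⟨m, P, Q, α, hP, hQ, hc, hα, e⟩
    have hcore := core hP hQ hc
    change U = α • (P * NormedSpace.exp (th • ∑ j, Q j)) at e
    have hα4 : (α * α) ^ 4 = 1 := by rw [← hα]; ring
    have hαs : α * star α = 1 := mul_star_of_pow (by norm_num) hα
    refine ⟨⟨hU, fun A hA => ?_⟩, ?_⟩
    · rw [e, Matrix.conjTranspose_smul, smul_mul_assoc, smul_mul_smul_comm, hαs, one_smul]
      exact hcore.2 A hA
    · rw [e, smul_mul_smul_comm]
      obtain ⟨v, hv⟩ := isPauli_iff.1 hcore.1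
      exact isPauli_iff.2 ⟨v, hv.smul hα4⟩


end
end

section
/- Let C be a Pauli-Square-Root Clifford (PSC) on a t-qubit register and let P be any Pauli operator on the (t+1)-qubit system consisting of one control qubit plus the register. Then there exist a (t+1)-qubit Pauli operator P', a t-qubit Pauli operator Q, and b ∈ {0,1} such that C(C)·P = (I⊗C^b)·C(Q)·P'·C(C), where Q either commutes or anticommutes with C, and the support of Q is contained in the support of C. -/
open Matrix Complex

noncomputable section

lemma psc_sq {s : ℂ} (hs : s ^ 2 = 1) : s = 1 ∨ s = -1 := by
  simpa using hs

lemma psc_tensorOp_mul {n : ℕ} (σ τ : Fin n → Matrix (Fin 2) (Fin 2) ℂ) :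
    tensorOp σ * tensorOp τ = tensorOp (fun i => σ i * τ i) := by
  ext x y
  simp only [tensorOp, Matrix.mul_apply, Finset.prod_univ_sum, Fintype.piFinset_univ,
    Finset.prod_mul_distrib]

lemma psc_tensorOp_smul {n : ℕ} (c : Fin n → ℂ) (σ : Fin n → Matrix (Fin 2) (Fin 2) ℂ) :
    tensorOp (fun i => c i • σ i) = (∏ i, c i) • tensorOp σ := by
  ext x y
  simp [tensorOp, Finset.prod_mul_distrib]

lemma psc_tensorOp_one {n : ℕ} : tensorOp (fun _ : Fin n => 1) = 1 := by
  ext x y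
  by_cases h : x = y
  · subst h; simp [tensorOp]
  · rw [Matrix.one_apply_ne h]
    obtain ⟨i, hi⟩ := Function.ne_iff.mp h
    exact Finset.prod_eq_zero (Finset.mem_univ i) (Matrix.one_apply_ne hi)

lemma psc_tensorOp_conj {n : ℕ} (σ : Fin n → Matrix (Fin 2) (Fin 2) ℂ) :
    (tensorOp σ)ᴴ = tensorOp (fun i => (σ i)ᴴ) := by
  ext x y
  simp [tensorOp, Matrix.conjTranspose_apply]

/-- single-qubit Pauli -/
def PscP1 (a : Matrix (Fin 2) (Fin 2) ℂ) : Prop := a = 1 ∨ a = PauliX ∨ a = PauliY ∨ a = PauliZ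

lemma psc_negI : (-I : ℂ) ^ 4 = 1 := by
  linear_combination (I ^ 2 - 1) * I_sq

lemma psc_phase (γ : ℂ) :
    (γ = 1 ∨ γ = -1 ∨ γ = Complex.I ∨ γ = -Complex.I) ↔ γ ^ 4 = 1 := by
  constructor
  · rintro (h | h | h | h) <;> rw [h] <;> first | exact I_pow_four | exact psc_negI | norm_num
  · intro h
    have : (γ - 1) * ((γ + 1) * ((γ - I) * (γ + I))) = 0 := by
      linear_combination h + (γ ^ 2 - 1) * (-I_sq)
    rcases mul_eq_zero.mp this with h | h
    · left; linear_combination h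
    rcases mul_eq_zero.mp h with h | h
    · right; left; linear_combination h
    rcases mul_eq_zero.mp h with h | h
    · right; right; left; linear_combination h
    · right; right; right; linear_combination h

lemma psc_one_eq : (1 : Matrix (Fin 2) (Fin 2) ℂ) = !![1, 0; 0, 1] := by
  ext i j; fin_cases i <;> fin_cases j <;> simp

lemma psc_P1_mul (a b : Matrix (Fin 2) (Fin 2) ℂ) (ha : PscP1 a) (hb : PscP1 b) :
    ∃ (c : ℂ) (d : Matrix (Fin 2) (Fin 2) ℂ), c ^ 4 = 1 ∧ PscP1 d ∧ a * b = c • d := by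
  have key : ∀ (c : ℂ) (d : Matrix (Fin 2) (Fin 2) ℂ), c ^ 4 = 1 → PscP1 d → a * b = c • d →
    ∃ (c : ℂ) (d : Matrix (Fin 2) (Fin 2) ℂ), c ^ 4 = 1 ∧ PscP1 d ∧ a * b = c • d :=
    fun c d h1 h2 h3 => ⟨c, d, h1, h2, h3⟩
  rcases ha with rfl | ha
  · exact key 1 b (by simp) hb (by simp)
  rcases hb with rfl | hb
  · exact key 1 a (by simp) (Or.inr ha) (by simp)
  rcases ha with rfl | rfl | rfl <;> rcases hb with rfl | rfl | rfl
  · exact key 1 1 (by simp) (by simp [PscP1]) (by simp [psc_one_eq, PauliX])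
  · exact key I PauliZ (by simp) (by simp [PscP1]) (by simp [PauliX, PauliY, PauliZ])
  · exact key (-I) PauliY psc_negI (by simp [PscP1]) (by simp [PauliX, PauliY, PauliZ])
  · exact key (-I) PauliZ psc_negI (by simp [PscP1]) (by simp [PauliX, PauliY, PauliZ])
  · exact key 1 1 (by simp) (by simp [PscP1]) (by simp [psc_one_eq, PauliY])
  · exact key I PauliX (by simp) (by simp [PscP1]) (by simp [PauliX, PauliY, PauliZ])
  · exact key I PauliY (by simp) (by simp [PscP1]) (by simp [PauliX, PauliY, PauliZ])
  · exact key (-I) PauliX psc_negI (by simp [PscP1]) (by simp [PauliX, PauliY, PauliZ])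
  · exact key 1 1 (by simp) (by simp [PscP1]) (by simp [psc_one_eq, PauliZ])

lemma psc_P1_herm (a : Matrix (Fin 2) (Fin 2) ℂ) (ha : PscP1 a) : aᴴ = a := by
  rcases ha with rfl | rfl | rfl | rfl <;> ext i j <;> fin_cases i <;> fin_cases j <;>
    simp [PauliX, PauliY, PauliZ]

lemma psc_P1_sq (a : Matrix (Fin 2) (Fin 2) ℂ) (ha : PscP1 a) : a * a = 1 := by
  rcases ha with rfl | rfl | rfl | rfl <;> simp [psc_one_eq, PauliX, PauliY, PauliZ]

lemma psc_P1_comm (a b : Matrix (Fin 2) (Fin 2) ℂ) (ha : PscP1 a) (hb : PscP1 b) :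
    ∃ s : ℂ, s ^ 2 = 1 ∧ a * b = s • (b * a) := by
  have h1 : a * b = b * a → ∃ s : ℂ, s ^ 2 = 1 ∧ a * b = s • (b * a) :=
    fun h => ⟨1, by simp, by simp [h]⟩
  have h2 : a * b = -(b * a) → ∃ s : ℂ, s ^ 2 = 1 ∧ a * b = s • (b * a) :=
    fun h => ⟨-1, by simp, by simp [h]⟩
  rcases ha with rfl | rfl | rfl | rfl <;> rcases hb with rfl | rfl | rfl | rfl <;>
    first
    | (refine h1 ?_; simp [PauliX, PauliY, PauliZ]; done)
    | (refine h2 ?_; simp [PauliX, PauliY, PauliZ]; done)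

lemma psc_isPauli_iff {n : ℕ} (P : QOp n) : IsPauli P ↔ ∃ (γ : ℂ)
    (σ : Fin n → Matrix (Fin 2) (Fin 2) ℂ), γ ^ 4 = 1 ∧ (∀ i, PscP1 (σ i)) ∧
    P = γ • tensorOp σ := by
  simp only [IsPauli, psc_phase, PscP1]

/-- commute up to sign -/
def PscCS {n : ℕ} (A B : QOp n) : Prop := ∃ s : ℂ, s ^ 2 = 1 ∧ A * B = s • (B * A)

lemma psc_mul {n : ℕ} {A B : QOp n} (hA : IsPauli A) (hB : IsPauli B) : IsPauli (A * B) := by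
  rw [psc_isPauli_iff] at *
  obtain ⟨g, σ, hg, hσ, rfl⟩ := hA
  obtain ⟨k, τ, hk, hτ, rfl⟩ := hB
  choose c d hc hd h using fun i => psc_P1_mul (σ i) (τ i) (hσ i) (hτ i)
  refine ⟨g * k * ∏ i, c i, d, ?_, hd, ?_⟩
  · rw [mul_pow, mul_pow, hg, hk, ← Finset.prod_pow]; simp [hc]
  · rw [smul_mul_assoc, mul_smul_comm, psc_tensorOp_mul]
    simp only [h]
    rw [psc_tensorOp_smul, smul_smul, smul_smul, mul_assoc]

lemma psc_herm {n : ℕ} {A : QOp n} (hA : IsPauli A) :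
    ∃ s : ℂ, s ^ 2 = 1 ∧ Aᴴ = s • A := by
  obtain ⟨g, σ, hg, hσ, rfl⟩ := hA
  have : (tensorOp σ)ᴴ = tensorOp σ := by
    rw [psc_tensorOp_conj]; congr 1; ext1 i; exact psc_P1_herm _ (hσ i)
  rw [conjTranspose_smul, this]
  rcases hg with rfl | rfl | rfl | rfl
  · exact ⟨1, by simp, by simp⟩
  · exact ⟨1, by simp, by simp⟩
  · exact ⟨-1, by simp, by simp⟩
  · exact ⟨-1, by simp, by simp⟩

lemma psc_smul {n : ℕ} {A : QOp n} (hA : IsPauli A) {s : ℂ} (hs : s ^ 2 = 1) :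
    IsPauli (s • A) := by
  rw [psc_isPauli_iff] at *
  obtain ⟨g, σ, hg, hσ, rfl⟩ := hA
  refine ⟨s * g, σ, ?_, hσ, by rw [smul_smul]⟩
  linear_combination (s^4) * hg + (s^2+1)*hs

lemma psc_conj {n : ℕ} {A : QOp n} (hA : IsPauli A) : IsPauli Aᴴ := by
  obtain ⟨s, hs, h⟩ := psc_herm hA
  rw [h]; exact psc_smul hA hs

lemma psc_unit {n : ℕ} {A : QOp n} (hA : IsPauli A) : A * Aᴴ = 1 ∧ Aᴴ * A = 1 := by
  have : A * Aᴴ = 1 := by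
    obtain ⟨g, σ, hg, hσ, rfl⟩ := hA
    have : (tensorOp σ)ᴴ = tensorOp σ := by
      rw [psc_tensorOp_conj]; congr 1; ext1 i; exact psc_P1_herm _ (hσ i)
    rw [conjTranspose_smul, this, smul_mul_assoc, mul_smul_comm, psc_tensorOp_mul]
    simp only [psc_P1_sq _ (hσ _)]
    rw [psc_tensorOp_one]
    rcases hg with rfl | rfl | rfl | rfl <;> simp [smul_smul]
  exact ⟨this, mul_eq_one_comm.mp this⟩

lemma psc_comm {n : ℕ} {A B : QOp n} (hA : IsPauli A) (hB : IsPauli B) : PscCS A B := by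
  obtain ⟨g, σ, hg, hσ, rfl⟩ := hA
  obtain ⟨k, τ, hk, hτ, rfl⟩ := hB
  choose c hc h using fun i => psc_P1_comm (σ i) (τ i) (hσ i) (hτ i)
  refine ⟨∏ i, c i, ?_, ?_⟩
  · rw [← Finset.prod_pow]; simp [hc]
  · simp only [smul_mul_assoc, mul_smul_comm, psc_tensorOp_mul, h, psc_tensorOp_smul, smul_smul]
    congr 1; ring

lemma psc_cs_iff {n : ℕ} {A B : QOp n} (h : PscCS A B) : CommOrAnticomm A B := by
  obtain ⟨s, hs, h⟩ := h
  rcases psc_sq hs with rfl | rfl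
  · left; simpa using h
  · right; simpa using h

/-- single-site operator -/
def pscSite {n : ℕ} (a : Matrix (Fin 2) (Fin 2) ℂ) (i : Fin n) : QOp n :=
  tensorOp (Function.update (fun _ => 1) i a)

lemma psc_site_pauli {n : ℕ} (a : Matrix (Fin 2) (Fin 2) ℂ) (ha : PscP1 a) (i : Fin n) :
    IsPauli (pscSite a i) := by
  refine ⟨1, _, Or.inl rfl, ?_, (one_smul _ _).symm⟩
  intro j
  by_cases h : j = i
  · subst h; rw [Function.update_self]; exact ha
  · simp [h]

lemma psc_site_apply {n : ℕ} (a : Matrix (Fin 2) (Fin 2) ℂ) (i : Fin n) (x y : Fin n → Fin 2) :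
    pscSite a i x y = if (∀ j, j ≠ i → x j = y j) then a (x i) (y i) else 0 := by
  unfold pscSite tensorOp
  rw [← Finset.mul_prod_erase _ _ (Finset.mem_univ i)]
  simp only [Function.update_self]
  split_ifs with h
  · rw [Finset.prod_eq_one, mul_one]
    intro j hj
    have hj := Finset.ne_of_mem_erase hj
    simp [hj, h j hj]
  · push Not at h
    obtain ⟨j, hj, h⟩ := h
    rw [Finset.prod_eq_zero (i := j), mul_zero]
    · simp [hj]
    · simp [hj, h]

lemma psc_site_mul {n : ℕ} (a : Matrix (Fin 2) (Fin 2) ℂ) (i : Fin n) (A : QOp n)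
    (x y : Fin n → Fin 2) :
    (pscSite a i * A) x y = ∑ c, a (x i) c * A (Function.update x i c) y := by
  rw [Matrix.mul_apply]
  symm
  apply Finset.sum_of_injOn (fun c => Function.update x i c)
  · intro c _ d _ h
    simpa using congrFun h i
  · simp
  · intro z _ hz
    rw [psc_site_apply, if_neg, zero_mul]
    intro h
    apply hz
    refine ⟨z i, by simp, ?_⟩
    ext1 j
    by_cases hj : j = i
    · subst hj; simp
    · simp [hj, h j hj]
  · intro c _
    rw [psc_site_apply, if_pos]
    · simp
    · intro j hj; simp [hj]

lemma psc_mul_site {n : ℕ} (a : Matrix (Fin 2) (Fin 2) ℂ) (i : Fin n) (A : QOp n)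
    (x y : Fin n → Fin 2) :
    (A * pscSite a i) x y = ∑ c, A x (Function.update y i c) * a c (y i) := by
  rw [Matrix.mul_apply]
  symm
  apply Finset.sum_of_injOn (fun c => Function.update y i c)
  · intro c _ d _ h
    simpa using congrFun h i
  · simp
  · intro z _ hz
    rw [psc_site_apply, if_neg, mul_zero]
    intro h
    apply hz
    refine ⟨z i, by simp, ?_⟩
    ext1 j
    by_cases hj : j = i
    · subst hj; simp
    · simp [hj, h j hj]
  · intro c _
    rw [psc_site_apply, if_pos]
    · simp
    · intro j hj; simp [hj]

lemma psc_triv_comm {n : ℕ} (a : Matrix (Fin 2) (Fin 2) ℂ) (i : Fin n) (A : QOp n)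
    (h : actsTriviallyOn A i) : pscSite a i * A = A * pscSite a i := by
  ext x y
  rw [psc_site_mul, psc_mul_site]
  rw [Finset.sum_eq_single (y i), Finset.sum_eq_single (x i)]
  · rw [mul_comm]
    congr 1
    have := h.2 x y (y i) (x i)
    simpa using this
  · intro c _ hc
    rw [h.1, zero_mul]; simpa using hc.symm
  · simp
  · intro c _ hc
    rw [h.1 _ y, mul_zero]; simpa using hc
  · simp

lemma psc_comm_triv {n : ℕ} (i : Fin n) (A : QOp n)
    (hX : pscSite PauliX i * A = A * pscSite PauliX i)
    (hZ : pscSite PauliZ i * A = A * pscSite PauliZ i) : actsTriviallyOn A i := by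
  constructor
  · intro x y hxy
    have := congrFun (congrFun hZ x) y
    rw [psc_site_mul, psc_mul_site] at this
    have hx : x = Function.update x i (x i) := by simp
    have hy : y = Function.update y i (y i) := by simp
    have h2 : x i = 0 ∧ y i = 1 ∨ x i = 1 ∧ y i = 0 := by omega
    rcases h2 with ⟨h0, h1⟩ | ⟨h0, h1⟩
    · rw [h0] at hx; rw [h1] at hy
      simp [PauliZ, h0, h1, ← hx, ← hy] at this
      linear_combination this / 2
    · rw [h0] at hx; rw [h1] at hy
      simp [PauliZ, h0, h1, ← hx, ← hy] at this
      linear_combination -this / 2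
  · have key : ∀ x y, A (Function.update x i 0) (Function.update y i 0) =
      A (Function.update x i 1) (Function.update y i 1) := by
      intro x y
      have := congrFun (congrFun hX (Function.update x i 1)) (Function.update y i 0)
      rw [psc_site_mul, psc_mul_site] at this
      simpa [PauliX] using this
    intro x y c c'
    fin_cases c <;> fin_cases c' <;> simp [key]

lemma psc_tw_mul {n : ℕ} (a b : Matrix (Fin 2) (Fin 2) ℂ) (A B : QOp n) :
    tensorWith a A * tensorWith b B = tensorWith (a * b) (A * B) := by
  ext x y
  simp only [tensorWith, Matrix.mul_apply]
  rw [← (Fin.consEquiv (fun _ : Fin (n+1) => Fin 2)).sum_comp, Fintype.sum_prod_type,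
    Finset.sum_mul_sum]
  refine Finset.sum_congr rfl fun c _ => Finset.sum_congr rfl fun z _ => ?_
  simp [Fin.consEquiv]
  ring

lemma psc_ctrl {n : ℕ} (U : QOp n) :
    controlled U = tensorWith !![1, 0; 0, 0] 1 + tensorWith !![0, 0; 0, 1] U := by
  ext x y
  simp only [controlled, tensorWith, Matrix.add_apply, Matrix.one_apply]
  generalize x 0 = p
  generalize y 0 = q
  fin_cases p <;> fin_cases q <;> simp

lemma psc_tw_zero {n : ℕ} (A : QOp n) : tensorWith 0 A = 0 := by
  ext x y; simp [tensorWith]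

lemma psc_z1 : (of ![![0, 0], 0] : Matrix (Fin 2) (Fin 2) ℂ) = 0 := by
  ext i j; fin_cases i <;> fin_cases j <;> rfl

lemma psc_z2 : (of ![0, ![0, 0]] : Matrix (Fin 2) (Fin 2) ℂ) = 0 := by
  ext i j; fin_cases i <;> fin_cases j <;> rfl

lemma psc_tw_pauli {n : ℕ} {a : Matrix (Fin 2) (Fin 2) ℂ} (ha : PscP1 a) {A : QOp n}
    (hA : IsPauli A) : IsPauli (tensorWith a A) := by
  obtain ⟨g, σ, hg, hσ, rfl⟩ := hA
  refine ⟨g, Fin.cons a σ, hg, ?_, ?_⟩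
  · intro i
    refine Fin.cases ?_ (fun j => ?_) i
    · exact ha
    · exact hσ j
  · ext x y
    simp [tensorWith, tensorOp, Fin.prod_univ_succ, Fin.tail]
    ring

lemma psc_pauli_split {n : ℕ} {P : QOp (n+1)} (hP : IsPauli P) :
    ∃ (a : Matrix (Fin 2) (Fin 2) ℂ) (A : QOp n), PscP1 a ∧ IsPauli A ∧ P = tensorWith a A := by
  obtain ⟨g, σ, hg, hσ, rfl⟩ := hP
  refine ⟨σ 0, g • tensorOp (Fin.tail σ), hσ 0, ⟨g, Fin.tail σ, hg, fun i => hσ i.succ, rfl⟩, ?_⟩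
  ext x y
  simp [tensorWith, tensorOp, Fin.prod_univ_succ, Fin.tail]
  ring

lemma psc_conj_smul {n : ℕ} {s : ℂ} (hs : s ^ 2 = 1) (A : QOp n) : (s • A)ᴴ = s • Aᴴ := by
  rcases psc_sq hs with rfl | rfl <;> simp

/-- Commutation of the basic `Q` with `C`. -/
lemma psc_Q_comm {n : ℕ} {C R : QOp n} (hC : IsClifford C) (hS : IsPauli (C * C))
    (hR : IsPauli R) : PscCS (C * R * Cᴴ * Rᴴ) C := by
  obtain ⟨⟨u1, u2⟩, hcl⟩ := hC
  have hR' := hcl R hR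
  have hR'C : (C * R * Cᴴ) * C = C * R := by rw [mul_assoc, u2, mul_one]
  have hR'Cc : (C * R * Cᴴ)ᴴ * C = C * Rᴴ := by
    simp only [conjTranspose_mul, conjTranspose_conjTranspose, mul_assoc, u2, mul_one]
  obtain ⟨s, hs, h1⟩ := psc_comm hS (psc_conj hR)
  have hCR : C * (C * R * Cᴴ)ᴴ = s • (Rᴴ * C) := by
    calc C * (C * R * Cᴴ)ᴴ = (C * C * Rᴴ) * Cᴴ := by
          simp only [conjTranspose_mul, conjTranspose_conjTranspose, mul_assoc]
      _ = _ := by rw [h1, smul_mul_assoc, mul_assoc, mul_assoc, u1, mul_one]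
  generalize C * R * Cᴴ = R' at *
  obtain ⟨h, hh, e1⟩ := psc_herm hR
  obtain ⟨h', hh', e2⟩ := psc_herm hR'
  obtain ⟨r, hr, e3⟩ := psc_comm hR hR'
  have e4 : Rᴴ * C = s • (C * R'ᴴ) := by
    rw [hCR, smul_smul, ← sq, hs, one_smul]
  refine ⟨s * h' * r * h, ?_, ?_⟩
  · simp [mul_pow, hs, hh', hr, hh]
  · rw [mul_assoc, e4, e2, e1]
    simp only [mul_smul_comm]
    rw [← mul_assoc, hR'C, mul_assoc, e3]
    simp only [mul_smul_comm, smul_smul]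
    congr 1
    linear_combination (-s * h' * r) * hh

lemma psc_site_Q {n : ℕ} {C R E : QOp n} (hE : IsPauli E) (hR : IsPauli R)
    (h : E * C = C * E) (h' : E * Cᴴ = Cᴴ * E) :
    E * (C * R * Cᴴ * Rᴴ) = (C * R * Cᴴ * Rᴴ) * E := by
  obtain ⟨r, hr, e⟩ := psc_comm hE hR
  obtain ⟨k, hk, e1⟩ := psc_herm hR
  rw [e1]
  calc E * (C * R * Cᴴ * (k • R)) = k • ((E * C) * R * Cᴴ * R) := by
        simp only [mul_smul_comm, mul_assoc]
    _ = k • (C * (E * R) * Cᴴ * R) := by rw [h]; simp only [mul_assoc]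
    _ = (k * r) • (C * R * (E * Cᴴ) * R) := by
        rw [e]; simp only [mul_smul_comm, smul_mul_assoc, smul_smul, mul_assoc]
    _ = (k * r) • (C * R * Cᴴ * (E * R)) := by rw [h']; simp only [mul_assoc]
    _ = (k * r * r) • (C * R * Cᴴ * R * E) := by
        rw [e]; simp only [mul_smul_comm, smul_smul, mul_assoc]
    _ = _ := by
        rw [mul_assoc k, ← sq, hr]; simp only [mul_smul_comm, smul_mul_assoc, mul_one]

lemma psc_site_herm {n : ℕ} (a : Matrix (Fin 2) (Fin 2) ℂ) (ha : PscP1 a) (i : Fin n) :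
    (pscSite a i)ᴴ = pscSite a i := by
  unfold pscSite
  rw [psc_tensorOp_conj]
  congr 1; ext1 j
  by_cases h : j = i
  · subst h; simpa using psc_P1_herm a ha
  · simp [h]

lemma psc_site_all {n : ℕ} {C R : QOp n} {i : Fin n} (a : Matrix (Fin 2) (Fin 2) ℂ)
    (ha : PscP1 a) (hR : IsPauli R) (h : actsTriviallyOn C i) :
    pscSite a i * (C * R * Cᴴ * Rᴴ) = (C * R * Cᴴ * Rᴴ) * pscSite a i ∧
    pscSite a i * ((C * R * Cᴴ * Rᴴ)ᴴ * (C * C)) =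
      ((C * R * Cᴴ * Rᴴ)ᴴ * (C * C)) * pscSite a i := by
  have h1 := psc_triv_comm a i C h
  have hE := psc_site_herm a ha i
  have h2 : pscSite a i * Cᴴ = Cᴴ * pscSite a i := by
    have := congrArg conjTranspose h1
    rw [conjTranspose_mul, conjTranspose_mul, hE] at this
    exact this.symm
  have h3 := psc_site_Q (psc_site_pauli a ha i) hR h1 h2
  refine ⟨h3, ?_⟩
  have h4 := congrArg conjTranspose h3
  rw [conjTranspose_mul, conjTranspose_mul _ (pscSite a i), hE] at h4
  exact (Commute.mul_right (h4.symm : Commute _ _) (Commute.mul_right h1 h1))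

theorem controlled_psc_prop_general {t : ℕ} (C : QOp t) (hC : IsPSC C)
    (P : QOp (t+1)) (hP : IsPauli P) :
    ∃ (P' : QOp (t+1)) (Q : QOp t) (b : ℕ),
      IsPauli P' ∧ IsPauli Q ∧ b ≤ 1 ∧
      CommOrAnticomm Q C ∧ Supp Q ⊆ Supp C ∧
      controlled C * P = tensorWith 1 (C ^ b) * (controlled Q * (P' * controlled C)) := by
  obtain ⟨hcl, -, hS⟩ := hC
  obtain ⟨a, R, ha, hR, rfl⟩ := psc_pauli_split hP
  have hR' := hcl.2 R hR
  have hQ : IsPauli (C * R * Cᴴ * Rᴴ) := psc_mul hR' (psc_conj hR)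
  have hQC := psc_Q_comm hcl hS hR
  obtain ⟨u1, u2⟩ := hcl.1
  obtain ⟨r1, r2⟩ := psc_unit hR
  have hX : PscP1 PauliX := by simp [PscP1]
  have hZ : PscP1 PauliZ := by simp [PscP1]
  have case1 : (a = 1 ∨ a = PauliZ) ∨ (a = PauliX ∨ a = PauliY) := by
    rcases ha with h | h | h | h <;> simp [h]
  rcases case1 with ha' | ha'
  · refine ⟨tensorWith a R, _, 0, psc_tw_pauli ha hR, hQ, by norm_num, psc_cs_iff hQC, ?_, ?_⟩
    · intro i hi hi'
      exact hi (psc_comm_triv i _ (psc_site_all _ hX hR hi').1 (psc_site_all _ hZ hR hi').1)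
    · have e : C * R * Cᴴ * Rᴴ * (R * C) = C * R := by
        calc _ = C * R * Cᴴ * (Rᴴ * R) * C := by simp only [mul_assoc]
          _ = _ := by rw [r2, mul_one, mul_assoc, u2, mul_one]
      simp only [psc_ctrl, mul_add, add_mul, psc_tw_mul, one_mul, mul_one, pow_zero, e]
      rcases ha' with rfl | rfl <;> simp [psc_one_eq, PauliZ, psc_tw_zero, psc_z1, psc_z2]
  · have hQ2 := psc_mul (psc_conj hQ) hS
    have hR'' : IsPauli (Cᴴ * R * Cᴴ) := by
      have := psc_mul (psc_conj hS) hR'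
      convert this using 1
      calc Cᴴ * R * Cᴴ = Cᴴ * (Cᴴ * C) * R * Cᴴ := by rw [u2, mul_one]
        _ = _ := by simp only [conjTranspose_mul, mul_assoc]
    refine ⟨tensorWith a (Cᴴ * R * Cᴴ), _, 1, psc_tw_pauli ha hR'', hQ2, le_rfl, ?_, ?_, ?_⟩
    · apply psc_cs_iff
      obtain ⟨s, hs, e⟩ := hQC
      obtain ⟨k, hk, e1⟩ := psc_herm hQ
      refine ⟨s, hs, ?_⟩
      rw [e1]
      generalize C * R * Cᴴ * Rᴴ = Q at *
      calc k • Q * (C * C) * C = k • ((Q * C) * (C * C)) := by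
            simp only [smul_mul_assoc, mul_assoc]
        _ = _ := by
            rw [e]; simp only [smul_mul_assoc, mul_smul_comm, mul_assoc, smul_comm k s]
    · intro i hi hi'
      exact hi (psc_comm_triv i _ (psc_site_all _ hX hR hi').2 (psc_site_all _ hZ hR hi').2)
    · have e : (C * R * Cᴴ * Rᴴ)ᴴ * (C * C) * (Cᴴ * R * Cᴴ) = R := by
        calc _ = R * (C * (Rᴴ * (Cᴴ * C) * (C * Cᴴ) * R) * Cᴴ) := by
              simp only [conjTranspose_mul, conjTranspose_conjTranspose, mul_assoc]
          _ = _ := by rw [u1, u2, mul_one, mul_one, r2, mul_one, u1, mul_one]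
      have e2 : C * (Cᴴ * R * Cᴴ * C) = R := by
        calc _ = (C * Cᴴ) * R * (Cᴴ * C) := by simp only [mul_assoc]
          _ = _ := by rw [u1, u2, mul_one, one_mul]
      simp only [psc_ctrl, mul_add, add_mul, psc_tw_mul, one_mul, mul_one, pow_one, e, e2]
      rcases ha' with rfl | rfl <;>
        simp [PauliX, PauliY, psc_tw_zero, psc_z1, psc_z2, add_comm]

end
end

section
/- Let U and V be unitaries on a common n-qubit register. Consider the system of two control qubits a and b plus the register, and let C_a(U) denote U controlled on qubit a and C_b(V) denote V controlled on qubit b, both targeting the register. If UV = −VU, then C_a(U)·C_b(V) = CZ_{ab}·C_b(V)·C_a(U), where CZ_{ab} is the controlled-Z gate acting on qubits a and b. If instead UV = VU, then C_a(U) and C_b(V) commute. -/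
open Matrix Complex

noncomputable section

/-- The register part of a state of two control qubits (qubits `0`, `1`) plus an
`n`-qubit register. -/
def reg2 {n : ℕ} (x : Fin (n+2) → Fin 2) : Fin n → Fin 2 := fun i => x i.succ.succ

/-- `U` controlled on qubit `0` (identity on qubit `1`), targeting the register. -/
def controlledA {n : ℕ} (U : QOp n) : QOp (n+2) :=
  fun x y =>
    (if x 1 = y 1 then 1 else 0) *
      (if x 0 = y 0 then
        (if x 0 = 0 then (if reg2 x = reg2 y then 1 else 0) else U (reg2 x) (reg2 y))
       else 0)

/-- `V` controlled on qubit `1` (identity on qubit `0`), targeting the register. -/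
def controlledB {n : ℕ} (V : QOp n) : QOp (n+2) :=
  fun x y =>
    (if x 0 = y 0 then 1 else 0) *
      (if x 1 = y 1 then
        (if x 1 = 0 then (if reg2 x = reg2 y then 1 else 0) else V (reg2 x) (reg2 y))
       else 0)

/-- The controlled-`Z` gate on the two control qubits `0` and `1` (identity on register). -/
def CZab {n : ℕ} : QOp (n+2) :=
  fun x y => if x = y then (if x 0 = 1 ∧ x 1 = 1 then -1 else 1) else 0

def blk2 {n : ℕ} (M : Fin 2 → Fin 2 → QOp n) : QOp (n+2) :=
  fun x y => if x 0 = y 0 ∧ x 1 = y 1 then M (x 0) (x 1) (reg2 x) (reg2 y) else 0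

def splitEquiv (n : ℕ) : (Fin 2 × Fin 2 × (Fin n → Fin 2)) ≃ (Fin (n+2) → Fin 2) where
  toFun p := Fin.cons p.1 (Fin.cons p.2.1 p.2.2 : Fin (n+1) → Fin 2)
  invFun x := (x 0, x 1, reg2 x)
  left_inv p := by
    obtain ⟨a, b, r⟩ := p
    rfl
  right_inv x := by
    funext i
    refine Fin.cases ?_ (fun i => ?_) i
    · rfl
    · refine Fin.cases ?_ (fun i => ?_) i <;> rfl

theorem ext2 {n : ℕ} (x y : Fin (n+2) → Fin 2) :
    x = y ↔ (x 0 = y 0 ∧ x 1 = y 1) ∧ reg2 x = reg2 y := by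
  rw [← (splitEquiv n).symm.injective.eq_iff]
  simp [splitEquiv, and_assoc]

theorem blk2_mul {n : ℕ} (M N : Fin 2 → Fin 2 → QOp n) :
    blk2 M * blk2 N = blk2 (fun a b => M a b * N a b) := by
  ext x y
  rw [Matrix.mul_apply, ← (splitEquiv n).sum_comp, Fintype.sum_prod_type]
  simp only [Fintype.sum_prod_type]
  have h0 : ∀ a b r, (splitEquiv n (a, b, r)) 0 = a := fun _ _ _ => rfl
  have h1 : ∀ a b r, (splitEquiv n (a, b, r)) 1 = b := fun _ _ _ => rfl
  have h2 : ∀ a b r, reg2 (splitEquiv n (a, b, r)) = r := fun _ _ _ => rfl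
  simp only [blk2, h0, h1, h2]
  rw [Finset.sum_eq_single (x 0), Finset.sum_eq_single (x 1)]
  · by_cases h : x 0 = y 0 ∧ x 1 = y 1
    · simp [h, Matrix.mul_apply]
    · simp [h]
  · intro b _ hb
    simp [hb.symm]
  · simp
  · intro b _ hb
    simp [hb.symm]
  · simp

theorem controlledA_eq {n : ℕ} (U : QOp n) :
    controlledA U = blk2 (fun a _ => if a = 0 then 1 else U) := by
  ext x y
  simp only [controlledA, blk2]
  by_cases h0 : x 0 = y 0 <;> by_cases h1 : x 1 = y 1 <;> by_cases h : x 0 = 0 <;>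
    simp_all [Matrix.one_apply]

theorem controlledB_eq {n : ℕ} (U : QOp n) :
    controlledB U = blk2 (fun _ b => if b = 0 then 1 else U) := by
  ext x y
  simp only [controlledB, blk2]
  by_cases h0 : x 0 = y 0 <;> by_cases h1 : x 1 = y 1 <;> by_cases h : x 1 = 0 <;>
    simp_all [Matrix.one_apply]

theorem CZab_eq {n : ℕ} :
    (CZab : QOp (n+2)) = blk2 (fun a b => if a = 1 ∧ b = 1 then -1 else 1) := by
  ext x y
  simp only [CZab, blk2, ext2 x y]
  by_cases h : x 0 = y 0 ∧ x 1 = y 1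
  · rw [if_pos h]
    by_cases h3 : x 0 = 1 ∧ x 1 = 1
    · rw [if_pos h3, if_pos h3, Matrix.neg_apply, Matrix.one_apply]
      by_cases h2 : reg2 x = reg2 y <;> simp [h, h2]
    · rw [if_neg h3, if_neg h3, Matrix.one_apply]
      by_cases h2 : reg2 x = reg2 y <;> simp [h, h2]
  · simp [h]

/-- For unitaries `U`, `V` on a common register, with `U` controlled on
qubit `a` and `V` controlled on qubit `b`: if `UV = -VU`, then
`C_a(U)·C_b(V) = CZ_{ab}·C_b(V)·C_a(U)`; if `UV = VU`, the two controlled gates commute. -/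
theorem controlled_different_controls {n : ℕ} (U V : QOp n)
    (hU : IsUnitary U) (hV : IsUnitary V) :
    (U * V = -(V * U) →
      controlledA U * controlledB V = CZab * (controlledB V * controlledA U)) ∧
    (U * V = V * U →
      controlledA U * controlledB V = controlledB V * controlledA U) := by
  rw [controlledA_eq, controlledB_eq, CZab_eq, blk2_mul, blk2_mul, blk2_mul]
  constructor
  · intro h
    congr 1
    funext a b
    fin_cases a <;> fin_cases b <;> simp [h]
  · intro h
    congr 1
    funext a b
    fin_cases a <;> fin_cases b <;> simp [h]

end
end

section
/- Let U be a unitary on n qubits. The controlled gate C(U) is an element of the (n+1)-qubit Pauli group if and only if U = I or U = −I. -/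
open Matrix Complex

noncomputable section

/-- For a unitary `U` on `n` qubits, the controlled gate `C(U)` is an
element of the `(n+1)`-qubit Pauli group iff `U = I` or `U = -I`. -/
theorem controlled_isPauli_iff {n : ℕ} (U : QOp n) (hU : IsUnitary U) :
    IsPauli (controlled U) ↔ (U = 1 ∨ U = -1) := by
  have key : ∀ (τ : Fin (n+1) → Matrix (Fin 2) (Fin 2) ℂ) (a b : Fin 2) (x y : Fin n → Fin 2),
      tensorOp τ (Fin.cons a x) (Fin.cons b y) = τ 0 a b * ∏ i : Fin n, τ i.succ (x i) (y i) := by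
    intro τ a b x y
    simp [tensorOp, Fin.prod_univ_succ]
  have one_prod : ∀ x y : Fin n → Fin 2,
      (∏ i : Fin n, (1 : Matrix (Fin 2) (Fin 2) ℂ) (x i) (y i)) = if x = y then 1 else 0 := by
    intro x y
    split_ifs with h
    · subst h; simp
    · obtain ⟨i, hi⟩ := Function.ne_iff.mp h
      exact Finset.prod_eq_zero (Finset.mem_univ i) (Matrix.one_apply_ne hi)
  constructor
  · rintro ⟨γ, σ, -, hσ, h⟩
    have h0 : ∀ x y : Fin n → Fin 2, (if x = y then (1:ℂ) else 0)
        = γ * (σ 0 0 0 * ∏ i : Fin n, σ i.succ (x i) (y i)) := by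
      intro x y
      have := congrFun (congrFun h (Fin.cons 0 x)) (Fin.cons 0 y)
      rw [Matrix.smul_apply, key] at this
      simpa [controlled] using this
    have h1 : ∀ x y : Fin n → Fin 2, U x y
        = γ * (σ 0 1 1 * ∏ i : Fin n, σ i.succ (x i) (y i)) := by
      intro x y
      have := congrFun (congrFun h (Fin.cons 1 x)) (Fin.cons 1 y)
      rw [Matrix.smul_apply, key] at this
      simpa [controlled] using this
    rcases hσ 0 with e | e | e | e
    · left
      ext x y
      rw [h1, Matrix.one_apply, h0, e]
      simp
    · have := h0 0 0
      simp [e, PauliX] at this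
    · have := h0 0 0
      simp [e, PauliY] at this
    · right
      ext x y
      rw [h1, Matrix.neg_apply, Matrix.one_apply, h0, e]
      simp [PauliZ]
  · intro h
    have main : ∀ A : Matrix (Fin 2) (Fin 2) ℂ, (A = 1 ∨ A = PauliZ) → U = A 1 1 • (1 : QOp n) →
        IsPauli (controlled U) := by
      intro A hA hUA
      refine ⟨1, Fin.cons A (fun _ => 1), Or.inl rfl, ?_, ?_⟩
      · intro i
        refine Fin.cases ?_ (fun j => ?_) i
        · rcases hA with h | h <;> simp [h]
        · simp
      · ext x y
        rw [one_smul, ← Fin.cons_self_tail x, ← Fin.cons_self_tail y, key]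
        simp only [Fin.cons_zero, Fin.cons_succ, one_prod]
        generalize x 0 = a
        generalize y 0 = b
        rw [hUA]
        rcases hA with h | h <;> subst h <;> fin_cases a <;> fin_cases b <;>
          simp [controlled, PauliZ, Matrix.one_apply]
    rcases h with h | h
    · exact main 1 (Or.inl rfl) (by simp [h])
    · exact main PauliZ (Or.inr rfl) (by simp [h, PauliZ])

end
end

section
/- Let C be a single-qubit Clifford unitary with C² = I that is not proportional to a Pauli matrix, and let |ψ⟩ be a unit +1-eigenvector of C. Define the twirling map T_C(ρ) = (ρ + CρC†)/2 on 2×2 complex matrices. Then there exists a single-qubit Pauli operator P anticommuting with C such that for every single-qubit density matrix ρ (positive semidefinite 2×2 matrix with trace 1) there is a real number p ∈ [0,1] with T_C(ρ) = (1−p)·|ψ⟩⟨ψ| + p·P|ψ⟩⟨ψ|P†. -/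
open Matrix Complex
open scoped ComplexOrder

noncomputable section

/-- Membership in the single-qubit Pauli group. -/
def IsPauli1 (P : Matrix (Fin 2) (Fin 2) ℂ) : Prop :=
  ∃ (γ : ℂ) (σ : Matrix (Fin 2) (Fin 2) ℂ),
    (γ = 1 ∨ γ = -1 ∨ γ = Complex.I ∨ γ = -Complex.I) ∧
    (σ = 1 ∨ σ = PauliX ∨ σ = PauliY ∨ σ = PauliZ) ∧
    P = γ • σ

/-- A single-qubit Clifford unitary. -/
def IsClifford1 (C : Matrix (Fin 2) (Fin 2) ℂ) : Prop :=
  IsUnitary C ∧ ∀ P, IsPauli1 P → IsPauli1 (C * P * Cᴴ)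

lemma aux_core (C ψψ P ρ : Matrix (Fin 2) (Fin 2) ℂ) (hC2 : C * C = 1) (hH : Cᴴ = C)
    (htr : C.trace = 0)
    (hψ : ψψ = (2 : ℂ)⁻¹ • (1 + C)) (hPP : P * Pᴴ = 1) (hPC : P * C = -(C * P))
    (hρ : ρ.PosSemidef) (hρt : ρ.trace = 1) :
    ∃ p : ℝ, 0 ≤ p ∧ p ≤ 1 ∧
      (2 : ℂ)⁻¹ • (ρ + C * ρ * Cᴴ) =
        ((1 - p : ℝ) : ℂ) • ψψ + ((p : ℝ) : ℂ) • (P * ψψ * Pᴴ) := by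
  have hB : P * ψψ * Pᴴ = (2 : ℂ)⁻¹ • (1 - C) := by
    rw [hψ]
    simp only [Matrix.mul_smul, Matrix.smul_mul, Matrix.mul_add, Matrix.mul_one, hPC,
      Matrix.add_mul, Matrix.neg_mul, Matrix.mul_assoc, hPP]
    rw [sub_eq_add_neg]
  have key : ∀ s : ℂ, s * s = 1 → star s = s →
      0 ≤ (2 : ℂ)⁻¹ * (1 + s * (C * ρ).trace) := by
    intro s hs hss
    have h := (hρ.conjTranspose_mul_mul_same ((2 : ℂ)⁻¹ • (1 + s • C))).trace_nonneg
    have e : (((2 : ℂ)⁻¹ • (1 + s • C))ᴴ * ρ * ((2 : ℂ)⁻¹ • (1 + s • C))).trace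
        = (2 : ℂ)⁻¹ * (1 + s * (C * ρ).trace) := by
      have e1 : ((2 : ℂ)⁻¹ • (1 + s • C))ᴴ = (2 : ℂ)⁻¹ • (1 + s • C) := by
        simp [Matrix.conjTranspose_smul, hH, hss]
      have e2 : ((2 : ℂ)⁻¹ • (1 + s • C)) * ((2 : ℂ)⁻¹ • (1 + s • C))
          = (2 : ℂ)⁻¹ • (1 + s • C) := by
        simp only [Matrix.mul_smul, Matrix.smul_mul, Matrix.mul_add, Matrix.mul_one,
          Matrix.add_mul, Matrix.one_mul, hC2, smul_smul, smul_add]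
        linear_combination (norm := module) (4⁻¹ : ℂ) • hs • (1 : Matrix (Fin 2) (Fin 2) ℂ)
      rw [e1, Matrix.trace_mul_comm, ← Matrix.mul_assoc, e2]
      simp [Matrix.add_mul, hρt]
      ring
    rwa [e] at h
  have k1 := key 1 (by norm_num) (by simp)
  have k2 := key (-1) (by norm_num) (by simp)
  obtain ⟨r1, i1⟩ := Complex.nonneg_iff.1 k1
  obtain ⟨r2, i2⟩ := Complex.nonneg_iff.1 k2
  set t := (C * ρ).trace with ht
  have him : t.im = 0 := by
    simp at i1
    linarith
  have htt : t = (t.re : ℂ) := by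
    apply Complex.ext <;> simp [him]
  simp at r1 r2
  refine ⟨(1 - t.re) / 2, by linarith, by linarith, ?_⟩
  rw [hB, hψ, hH]
  have hgoal : (2 : ℂ)⁻¹ • (ρ + C * ρ * C) = (2 : ℂ)⁻¹ • (1 + t • C) := by
    congr 1
    have c00 := congrFun (congrFun hC2 0) 0
    have c11 := congrFun (congrFun hC2 1) 1
    simp [Matrix.mul_apply, Fin.sum_univ_two] at c00 c11
    rw [Matrix.trace_fin_two] at htr hρt ht
    simp [Matrix.mul_apply, Fin.sum_univ_two] at ht
    have hd : C 1 1 = - C 0 0 := by linear_combination htr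
    have hr : ρ 1 1 = 1 - ρ 0 0 := by linear_combination hρt
    rw [ht]
    ext i j
    fin_cases i <;> fin_cases j <;>
      simp [Matrix.mul_apply, Fin.sum_univ_two, hd, hr]
    · linear_combination (1 - ρ 0 0) * c00
    · linear_combination (-ρ 0 1) * c00
    · linear_combination (-ρ 1 0) * c00
    · linear_combination (ρ 0 0) * c00
  rw [hgoal]
  rw [htt]
  push_cast
  simp only [Complex.ofReal_re]
  module

lemma aux_proj (a b u v : ℂ) (ha : star a = a)
    (h1 : a * u + b * v = u) (h2 : star b * u - a * v = v)
    (hn : star u * u + star v * v = 1) :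
    u * star u = 2⁻¹ * (1 + a) ∧ u * star v = 2⁻¹ * b ∧ v * star u = 2⁻¹ * star b ∧
      v * star v = 2⁻¹ * (1 - a) := by
  have h1' := congrArg star h1
  have h2' := congrArg star h2
  simp only [star_add, star_sub, star_mul', star_star, ha] at h1' h2'
  have q : (1 + a) * (v * star v) = (1 - a) * (u * star u) := by
    linear_combination (-star v) * h2 + u * h1'
  have quu : u * star u = 2⁻¹ * (1 + a) := by linear_combination (-1/2) * q + (1 + a) / 2 * hn
  have qvv : v * star v = 2⁻¹ * (1 - a) := by linear_combination hn - quu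
  refine ⟨quu, ?_, ?_, qvv⟩
  · linear_combination (-1/2) * star v * h1 - (1/2) * u * h2' + b / 2 * hn
  · linear_combination (-1/2) * v * h1' - (1/2) * star u * h2 + star b / 2 * hn

/-- Let `C` be a single-qubit Clifford with `C² = I`, not proportional to a
Pauli matrix, and `|ψ⟩` a unit `+1`-eigenvector of `C`. Then there is a Pauli `P`
anticommuting with `C` such that for every density matrix `ρ` there is `p ∈ [0,1]` with
`T_C(ρ) = (1-p)|ψ⟩⟨ψ| + p P|ψ⟩⟨ψ|P†`, where `T_C(ρ) = (ρ + CρC†)/2`. -/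
theorem twirl_psc_eigenstate (C : Matrix (Fin 2) (Fin 2) ℂ)
    (hC : IsClifford1 C) (hC2 : C * C = 1)
    (hnp : ¬ ∃ (c : ℂ) (σ : Matrix (Fin 2) (Fin 2) ℂ),
      (σ = 1 ∨ σ = PauliX ∨ σ = PauliY ∨ σ = PauliZ) ∧ C = c • σ)
    (ψ : Fin 2 → ℂ) (hunit : star ψ ⬝ᵥ ψ = 1) (heig : C.mulVec ψ = ψ) :
    ∃ P : Matrix (Fin 2) (Fin 2) ℂ, IsPauli1 P ∧ P * C = -(C * P) ∧
      ∀ ρ : Matrix (Fin 2) (Fin 2) ℂ, ρ.PosSemidef → ρ.trace = 1 →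
        ∃ p : ℝ, 0 ≤ p ∧ p ≤ 1 ∧
          (2 : ℂ)⁻¹ • (ρ + C * ρ * Cᴴ) =
            ((1 - p : ℝ) : ℂ) • Matrix.vecMulVec ψ (star ψ) +
              ((p : ℝ) : ℂ) • (P * Matrix.vecMulVec ψ (star ψ) * Pᴴ) := by
  obtain ⟨⟨hU1, hU2⟩, hCl⟩ := hC
  have hH : Cᴴ = C := by
    calc Cᴴ = Cᴴ * (C * C) := by rw [hC2, Matrix.mul_one]
      _ = C := by rw [← Matrix.mul_assoc, hU2, Matrix.one_mul]
  have c00 := congrFun (congrFun hC2 0) 0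
  have c01 := congrFun (congrFun hC2 0) 1
  have c10 := congrFun (congrFun hC2 1) 0
  have c11 := congrFun (congrFun hC2 1) 1
  simp [Matrix.mul_apply, Fin.sum_univ_two] at c00 c01 c10 c11
  have ha : star (C 0 0) = C 0 0 := congrFun (congrFun hH 0) 0
  have hb : star (C 0 1) = C 1 0 := congrFun (congrFun hH 1) 0
  have hd : C 1 1 = - C 0 0 := by
    by_contra hne
    have hne' : C 0 0 + C 1 1 ≠ 0 := fun h => hne (by linear_combination h)
    have b0 : C 0 1 = 0 := by
      apply (mul_eq_zero.1 (show C 0 1 * (C 0 0 + C 1 1) = 0 by linear_combination c01)).resolve_right hne'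
    have b1 : C 1 0 = 0 := by
      apply (mul_eq_zero.1 (show C 1 0 * (C 0 0 + C 1 1) = 0 by linear_combination c10)).resolve_right hne'
    have e : C 0 0 = C 1 1 := by
      have : (C 0 0 - C 1 1) * (C 0 0 + C 1 1) = 0 := by linear_combination c00 - c11
      linear_combination (mul_eq_zero.1 this).resolve_right hne'
    refine hnp ⟨C 0 0, 1, Or.inl rfl, ?_⟩
    ext i j
    fin_cases i <;> fin_cases j <;> simp [b0, b1, e]
  have hb0 : C 0 1 ≠ 0 := by
    intro h
    have h' : C 1 0 = 0 := by rw [← hb, h]; simp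
    refine hnp ⟨C 0 0, PauliZ, by simp, ?_⟩
    ext i j
    fin_cases i <;> fin_cases j <;> simp [h, h', hd, PauliZ]
  have htr : C.trace = 0 := by rw [Matrix.trace_fin_two, hd]; ring
  have hproj : Matrix.vecMulVec ψ (star ψ) = (2 : ℂ)⁻¹ • (1 + C) := by
    have e0 := congrFun heig 0
    have e1 := congrFun heig 1
    simp only [Matrix.mulVec, dotProduct, Fin.sum_univ_two] at e0 e1 hunit
    obtain ⟨p1, p2, p3, p4⟩ := aux_proj (C 0 0) (C 0 1) (ψ 0) (ψ 1) ha e0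
      (by rw [hb]; rw [hd] at e1; linear_combination e1) hunit
    rw [hb] at p3
    ext i j
    fin_cases i <;> fin_cases j <;>
      simp [Matrix.vecMulVec_apply, hd] <;> simp at p1 p2 p3 p4
    · exact p1
    · exact p2
    · exact p3
    · linear_combination p4
  have hex : ∃ P, IsPauli1 P ∧ P * Pᴴ = 1 ∧ P * C = -(C * P) := by
    have hcase : C 0 0 = 0 ∨ C 1 0 = C 0 1 ∨ C 1 0 = - C 0 1 := by
      obtain ⟨γ, σ, -, hσ, hP⟩ := hCl PauliZ ⟨1, PauliZ, by simp, by simp, by simp⟩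
      rw [hH] at hP
      have z01 := congrFun (congrFun hP 0) 1
      have z10 := congrFun (congrFun hP 1) 0
      by_cases h0 : C 0 0 = 0
      · exact Or.inl h0
      right
      rcases hσ with rfl | rfl | rfl | rfl <;>
        simp [Matrix.mul_apply, Fin.sum_univ_two, PauliX, PauliY, PauliZ, hd] at z01 z10
      · exact absurd (show C 0 0 * C 0 1 = 0 by linear_combination z01 / 2) (mul_ne_zero h0 hb0)
      · left
        apply mul_left_cancel₀ h0
        linear_combination z10 / 2 - z01 / 2
      · right
        apply mul_left_cancel₀ h0
        linear_combination z10 / 2 + z01 / 2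
      · exact absurd (show C 0 0 * C 0 1 = 0 by linear_combination z01 / 2) (mul_ne_zero h0 hb0)
    rcases hcase with h | h | h
    · refine ⟨PauliZ, ⟨1, PauliZ, by simp, by simp, by simp⟩, ?_, ?_⟩ <;> ext i j <;>
        fin_cases i <;> fin_cases j <;>
        simp [Matrix.mul_apply, Fin.sum_univ_two, PauliZ, hd, h]
    · refine ⟨PauliY, ⟨1, PauliY, by simp, by simp, by simp⟩, ?_, ?_⟩ <;> ext i j <;>
        fin_cases i <;> fin_cases j <;>
        simp [Matrix.mul_apply, Fin.sum_univ_two, PauliY, hd, h] <;> ring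
    · refine ⟨PauliX, ⟨1, PauliX, by simp, by simp, by simp⟩, ?_, ?_⟩ <;> ext i j <;>
        fin_cases i <;> fin_cases j <;>
        simp [Matrix.mul_apply, Fin.sum_univ_two, PauliX, hd, h]
  obtain ⟨P, hP, hPP, hPC⟩ := hex
  exact ⟨P, hP, hPC, fun ρ hρ hρt => aux_core C _ P ρ hC2 hH htr hproj hPP hPC hρ hρt⟩

end
end

section
/- Let V be a diagonal unitary on l qubits lying in the third level C^(3) of the Clifford hierarchy, and set |V⟩ = V|+⟩^⊗l where |+⟩ = (|0⟩+|1⟩)/√2. For z ∈ F₂^l write X_z = ⊗_{i=1}^l X^{z_i} and Z_x = ⊗_{i=1}^l Z^{x_i}, let S_V = {V X_z V† : z ∈ F₂^l}, and define the twirling map T_V(ρ) = 2^{−l} Σ_{z∈F₂^l} (V X_z V†) ρ (V X_z V†)†. Then for every l-qubit density matrix ρ there exist nonnegative reals {p_x}_{x∈F₂^l} summing to 1 such that T_V(ρ) = Σ_{x∈F₂^l} p_x · Z_x|V⟩⟨V|Z_x†. -/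
open Matrix Complex
open scoped ComplexOrder

noncomputable section

/-- The `l`-qubit `|+⟩^⊗l` state. -/
def plusVec (l : ℕ) : (Fin l → Fin 2) → ℂ := fun _ => ((Real.sqrt 2 : ℂ))⁻¹ ^ l

/-- The Pauli string `X_z = ⊗ᵢ X^{z_i}`. -/
def XString {l : ℕ} (z : Fin l → Fin 2) : QOp l := tensorOp (fun i => PauliX ^ (z i).val)

/-- The Pauli string `Z_x = ⊗ᵢ Z^{x_i}`. -/
def ZString {l : ℕ} (x : Fin l → Fin 2) : QOp l := tensorOp (fun i => PauliZ ^ (x i).val)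

/-- The character `χ_x(a)`. -/
def chiZ {l : ℕ} (x a : Fin l → Fin 2) : ℂ := ∏ i, (PauliZ ^ (x i).val) (a i) (a i)

lemma XString_apply {l : ℕ} (z a b : Fin l → Fin 2) :
    XString z a b = if b = a + z then 1 else 0 := by
  have h : ∀ p q r : Fin 2, (PauliX ^ p.val) q r = if r = q + p then (1 : ℂ) else 0 := by
    intro p q r
    fin_cases p <;> fin_cases q <;> fin_cases r <;> simp [PauliX]
  unfold XString tensorOp
  simp only [h, Finset.prod_ite_zero, Finset.prod_const_one, Finset.mem_univ, true_imp_iff,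
    funext_iff, Pi.add_apply]

lemma ZString_apply {l : ℕ} (x a b : Fin l → Fin 2) :
    ZString x a b = if a = b then chiZ x a else 0 := by
  have h : ∀ p q r : Fin 2, q ≠ r → (PauliZ ^ p.val) q r = (0 : ℂ) := by
    intro p q r
    fin_cases p <;> fin_cases q <;> fin_cases r <;> simp [PauliZ]
  unfold ZString tensorOp
  split_ifs with hab
  · subst hab; rfl
  · obtain ⟨i, hi⟩ := Function.ne_iff.mp hab
    exact Finset.prod_eq_zero (Finset.mem_univ i) (h _ _ _ hi)

lemma chiZ_star {l : ℕ} (x a : Fin l → Fin 2) : star (chiZ x a) = chiZ x a := by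
  have h : ∀ p q : Fin 2, star ((PauliZ ^ p.val) q q) = (PauliZ ^ p.val) q q := by
    intro p q
    fin_cases p <;> fin_cases q <;> simp [PauliZ]
  unfold chiZ
  rw [star_prod]
  simp only [h]

lemma chiZ_sum {l : ℕ} (a b c d : Fin l → Fin 2) :
    ∑ x, chiZ x a * chiZ x b * chiZ x c * chiZ x d = if d = a + b + c then (2 : ℂ) ^ l else 0 := by
  have h : ∀ p q r s : Fin 2, ∑ t : Fin 2, (PauliZ ^ t.val) p p * (PauliZ ^ t.val) q q *
      (PauliZ ^ t.val) r r * (PauliZ ^ t.val) s s = if s = p + q + r then (2 : ℂ) else 0 := by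
    intro p q r s
    fin_cases p <;> fin_cases q <;> fin_cases r <;> fin_cases s <;>
      simp [PauliZ, Fin.sum_univ_two] <;> norm_num
  unfold chiZ
  simp only [← Finset.prod_mul_distrib]
  have := Finset.prod_univ_sum (fun _ : Fin l => (Finset.univ : Finset (Fin 2)))
    (fun i t => (PauliZ ^ t.val) (a i) (a i) * (PauliZ ^ t.val) (b i) (b i) *
      (PauliZ ^ t.val) (c i) (c i) * (PauliZ ^ t.val) (d i) (d i))
  rw [Fintype.piFinset_univ] at this
  rw [← this]
  simp only [h, Finset.prod_ite_zero, Finset.prod_const, Finset.mem_univ, true_imp_iff,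
    funext_iff, Pi.add_apply, Finset.card_univ, Fintype.card_fin]

lemma add_self_bits {l : ℕ} (a : Fin l → Fin 2) : a + a = 0 := by
  have h : ∀ p : Fin 2, p + p = 0 := by decide
  funext i; exact h _

lemma chiZ_zero {l : ℕ} (x : Fin l → Fin 2) : chiZ x 0 = 1 := by
  have h : ∀ p : Fin 2, (PauliZ ^ p.val) 0 0 = (1 : ℂ) := by
    intro p
    fin_cases p <;> simp [PauliZ]
  unfold chiZ
  simp [h]

lemma chiZ_sum2 {l : ℕ} (c d : Fin l → Fin 2) :
    ∑ x, chiZ x c * chiZ x d = if d = c then (2 : ℂ) ^ l else 0 := by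
  have := chiZ_sum 0 0 c d
  simpa [chiZ_zero] using this

lemma s_sq (l : ℕ) : (((Real.sqrt 2 : ℂ))⁻¹ ^ l) * (((Real.sqrt 2 : ℂ))⁻¹ ^ l) =
    ((2 : ℂ) ^ l)⁻¹ := by
  rw [← mul_pow, ← mul_inv, ← Complex.ofReal_mul, Real.mul_self_sqrt (by norm_num)]
  simp

lemma twirl_entry {l : ℕ} (v : (Fin l → Fin 2) → ℂ) (ρ : QOp l) (z a b : Fin l → Fin 2) :
    ((diagonal v * XString z * (diagonal v)ᴴ) * ρ * (diagonal v * XString z * (diagonal v)ᴴ)ᴴ) a b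
      = v a * star (v (a + z)) * ρ (a + z) (b + z) * (v (b + z) * star (v b)) := by
  have hM : ∀ a b, (diagonal v * XString z * (diagonal v)ᴴ) a b =
      if b = a + z then v a * star (v b) else 0 := by
    intro a b
    rw [diagonal_conjTranspose, mul_diagonal, diagonal_mul, XString_apply]
    split_ifs <;> simp
  generalize diagonal v * XString z * (diagonal v)ᴴ = M at hM
  rw [Matrix.mul_apply]
  simp only [Matrix.mul_apply, conjTranspose_apply, hM, apply_ite star, star_zero, ite_mul,
    mul_ite, zero_mul, mul_zero, Finset.sum_ite_eq', Finset.sum_ite_eq, Finset.mem_univ, if_true,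
    star_mul', star_star]
  ring

lemma rhs_entry {l : ℕ} (w : (Fin l → Fin 2) → ℂ) (x a b : Fin l → Fin 2) :
    (ZString x * vecMulVec w (star w) * (ZString x)ᴴ) a b =
      (chiZ x a * w a) * star (chiZ x b * w b) := by
  have hZ : ZString x = diagonal (chiZ x) := by
    ext a b; rw [ZString_apply, diagonal_apply]
  rw [hZ, diagonal_conjTranspose, mul_diagonal, diagonal_mul, vecMulVec_apply]
  simp only [Pi.star_apply, star_mul']
  ring

/-- For a diagonal unitary `V ∈ C^(3)` on `l` qubits, with
`|V⟩ = V|+⟩^⊗l` and the twirl `T_V(ρ) = 2^{-l} Σ_z (V X_z V†) ρ (V X_z V†)†`, every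
`l`-qubit density matrix twirls to a probabilistic mixture of the states `Z_x|V⟩`. -/
theorem twirl_diagonal_third_level {l : ℕ} (V : QOp l)
    (hdiag : V.IsDiag) (hlevel : CliffordLevel 3 V)
    (ρ : QOp l) (hρ : ρ.PosSemidef) (htr : ρ.trace = 1) :
    ∃ p : (Fin l → Fin 2) → ℝ, (∀ x, 0 ≤ p x) ∧ (∑ x, p x) = 1 ∧
      ((2 : ℂ) ^ l)⁻¹ •
          ∑ z : Fin l → Fin 2, (V * XString z * Vᴴ) * ρ * (V * XString z * Vᴴ)ᴴ =
        ∑ x : Fin l → Fin 2, (p x : ℂ) •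
          (ZString x *
            Matrix.vecMulVec (V.mulVec (plusVec l)) (star (V.mulVec (plusVec l))) *
              (ZString x)ᴴ) := by
  have hU : IsUnitary V := hlevel.1
  obtain ⟨v, rfl⟩ : ∃ v, V = diagonal v := ⟨_, (hdiag.diagonal_diag).symm⟩
  have hv : ∀ a, v a * star (v a) = 1 := by
    intro a
    have := congrFun (congrFun hU.1 a) a
    simpa [diagonal_conjTranspose] using this
  set s : ℂ := ((Real.sqrt 2 : ℂ))⁻¹ ^ l with hs
  have hss : star s = s := by simp [hs]
  have hs2 : s * s = ((2 : ℂ) ^ l)⁻¹ := s_sq l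
  have h2 : (2 : ℂ) ^ l ≠ 0 := by positivity
  let w : (Fin l → Fin 2) → (Fin l → Fin 2) → ℂ := fun x a => chiZ x a * (v a * s)
  let q : (Fin l → Fin 2) → ℂ := fun x => star (w x) ⬝ᵥ (ρ *ᵥ (w x))
  have hq0 : ∀ x, 0 ≤ q x := fun x => hρ.dotProduct_mulVec_nonneg (w x)
  have hqr : ∀ x, ((q x).re : ℂ) = q x := fun x =>
    (Complex.eq_re_of_ofReal_le (r := 0) (by simpa using hq0 x)).symm
  have hq : ∀ x, q x = ∑ c, ∑ d, (chiZ x c * chiZ x d) *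
      (star (v c) * ρ c d * v d * (s * s)) := by
    intro x
    simp only [q, w, dotProduct, mulVec, Finset.mul_sum, Pi.star_apply, star_mul', chiZ_star, hss]
    refine Finset.sum_congr rfl fun c _ => Finset.sum_congr rfl fun d _ => ?_
    ring
  refine ⟨fun x => (q x).re, fun x => (Complex.le_def.mp (hq0 x)).1, ?_, ?_⟩
  · apply Complex.ofReal_injective
    rw [Complex.ofReal_sum, Complex.ofReal_one, Finset.sum_congr rfl fun x _ => hqr x]
    simp only [hq]
    rw [Finset.sum_comm]
    have key : ∀ c, ∑ x, ∑ d, chiZ x c * chiZ x d * (star (v c) * ρ c d * v d * (s * s)) =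
        (2 : ℂ) ^ l * (star (v c) * ρ c c * v c * (s * s)) := by
      intro c
      rw [Finset.sum_comm]
      simp only [← Finset.sum_mul, chiZ_sum2, ite_mul, zero_mul, Finset.sum_ite_eq',
        Finset.sum_ite_eq, Finset.mem_univ, if_true]
    simp only [key]
    rw [← htr, trace]
    refine Finset.sum_congr rfl fun c _ => ?_
    rw [hs2, diag_apply]
    have := hv c
    field_simp
    linear_combination (ρ c c) * this
  · ext a b
    rw [Matrix.smul_apply, Matrix.sum_apply, Matrix.sum_apply]
    simp only [Matrix.smul_apply, hqr, rhs_entry, twirl_entry, smul_eq_mul]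
    have hm : ∀ a, (diagonal v *ᵥ plusVec l) a = v a * s := by
      intro a; rw [mulVec_diagonal]; rfl
    simp only [hm, star_mul', chiZ_star, hss, hq, Finset.sum_mul]
    rw [Finset.sum_comm]
    have key : ∀ c, ∑ x, ∑ d, chiZ x c * chiZ x d * (star (v c) * ρ c d * v d * (s * s)) *
        (chiZ x a * (v a * s) * (chiZ x b * (star (v b) * s))) =
        (2 : ℂ) ^ l * (star (v c) * ρ c (a + b + c) * v (a + b + c) * (s * s) * (v a * s) *
          (star (v b) * s)) := by
      intro c
      rw [Finset.sum_comm]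
      have : ∀ d, ∑ x, chiZ x c * chiZ x d * (star (v c) * ρ c d * v d * (s * s)) *
        (chiZ x a * (v a * s) * (chiZ x b * (star (v b) * s))) =
        (if d = a + b + c then (2 : ℂ) ^ l else 0) * (star (v c) * ρ c d * v d * (s * s) *
          (v a * s) * (star (v b) * s)) := by
        intro d
        rw [← chiZ_sum, Finset.sum_mul]
        refine Finset.sum_congr rfl fun x _ => ?_
        ring
      simp only [this, ite_mul, zero_mul, Finset.sum_ite_eq', Finset.sum_ite_eq,
        Finset.mem_univ, if_true]
    simp only [key]
    rw [Finset.mul_sum, ← Equiv.sum_comp (Equiv.addLeft a)]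
    refine Finset.sum_congr rfl fun z _ => ?_
    have e : a + (a + z) = z := by
      rw [← add_assoc, add_self_bits, zero_add]
    have e2 : b + (a + z) = a + b + z := by abel
    simp only [Equiv.coe_addLeft, e, e2]
    have hs4 : (2 : ℂ) ^ l * (s * s) * (s * s) = ((2 : ℂ) ^ l)⁻¹ := by
      rw [hs2]; field_simp
    rw [← hs4]
    ring

end
end

section
/- Let n ≥ 1 and let ω be the 2n×2n matrix over F₂ given in block form by ω = [[0, I_n],[I_n, 0]], with symplectic product ⟨u,v⟩ = uᵀωv. Let C be a 2n×2n matrix over F₂ with CᵀωC = ω and C² = I, and set N = C + I (over F₂). Then: (i) ⟨Nx, Ny⟩ = 0 and ⟨Nx, y⟩ = ⟨x, Ny⟩ for all x, y ∈ F₂^{2n}; and (ii) there exist finitely many vectors u₁,…,u_m ∈ F₂^{2n} with ⟨u_i, u_j⟩ = 0 for all i, j, such that N = (Σ_{k=1}^m u_k u_kᵀ)·ω and C = Π_{k=1}^m (I + u_k u_kᵀ ω), where the factors I + u_k u_kᵀω commute pairwise. -/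
open Matrix

noncomputable section

/-- The standard binary symplectic form matrix `ω = [[0, Iₙ], [Iₙ, 0]]` over `F₂`. -/
def omegaMat (n : ℕ) : Matrix (Fin n ⊕ Fin n) (Fin n ⊕ Fin n) (ZMod 2) :=
  Matrix.fromBlocks 0 1 1 0

/-- The binary symplectic product `⟨u, v⟩ = uᵀ ω v`. -/
def sympl (n : ℕ) (u v : (Fin n ⊕ Fin n) → ZMod 2) : ZMod 2 :=
  u ⬝ᵥ (omegaMat n).mulVec v

lemma z2_add_self {ι : Type*} (A : Matrix ι ι (ZMod 2)) : A + A = 0 := by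
  ext i j
  exact CharTwo.add_self_eq_zero _

lemma omega_sq (n : ℕ) : omegaMat n * omegaMat n = 1 := by
  simp [omegaMat, Matrix.fromBlocks_multiply]

lemma omega_tr (n : ℕ) : (omegaMat n)ᵀ = omegaMat n := by
  simp [omegaMat, Matrix.fromBlocks_transpose]

lemma z2_ne_zero {a : ZMod 2} (h : a ≠ 0) : a = 1 := by
  revert a; decide

open Classical in
lemma sym_decomp {ι : Type*} [Fintype ι] (c : ℕ) :
    ∀ S : Matrix ι ι (ZMod 2), Sᵀ = S →
      (Finset.univ.filter (fun i => S i ≠ 0)).card ≤ c →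
      ∃ l : List (ι → ZMod 2), (∀ u ∈ l, ∃ a, u = S *ᵥ a) ∧
        (l.map (fun u => Matrix.vecMulVec u u)).sum = S := by
  induction c with
  | zero =>
    intro S _ hc
    have h0 : S = 0 := by
      ext i j
      have := Finset.card_eq_zero.mp (Nat.le_zero.mp hc)
      have hi : i ∉ Finset.univ.filter (fun i => S i ≠ 0) := by rw [this]; simp
      simp at hi
      simp [hi]
    exact ⟨[], by simp, by simp [h0]⟩
  | succ c ih =>
    intro S hS hc
    have sy : ∀ i j, S i j = S j i := fun i j => congrFun (congrFun hS j) i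
    -- a row killed while zero rows stay zero
    have key : ∀ S' : Matrix ι ι (ZMod 2), ∀ i, S i ≠ 0 → S' i = 0 →
        (∀ k, S k = 0 → S' k = 0) →
        (Finset.univ.filter (fun i => S' i ≠ 0)).card ≤ c := by
      intro S' i h1 h2 h3
      refine Nat.le_of_lt_succ (lt_of_lt_of_le (Finset.card_lt_card ?_) hc)
      refine ⟨?_, ?_⟩
      · intro k hk
        simp only [Finset.mem_filter, Finset.mem_univ, true_and] at hk ⊢
        exact fun h => hk (h3 k h)
      · intro h
        have := @h i (by simpa using h1)
        simp [h2] at this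
    have col : ∀ i, S i = S *ᵥ (Pi.single i 1) := by
      intro i; ext k; simp [sy i k]
    by_cases hd : ∃ i, S i i ≠ 0
    · obtain ⟨i, hi⟩ := hd
      have hi1 := z2_ne_zero hi
      obtain ⟨l, hl, hs⟩ := ih (S + vecMulVec (S i) (S i))
        (by ext a b; simp [vecMulVec_apply, sy b a, mul_comm])
        (key _ i (fun h => hi (by rw [h]; rfl))
          (by ext b; simp [vecMulVec_apply, hi1, CharTwo.add_self_eq_zero])
          (by intro k hk; ext b; simp [vecMulVec_apply, sy i k, hk]))
      refine ⟨S i :: l, ?_, ?_⟩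
      · intro u hu
        rcases List.mem_cons.mp hu with rfl | hu
        · exact ⟨_, col i⟩
        · obtain ⟨a, rfl⟩ := hl u hu
          refine ⟨a + (S i ⬝ᵥ a) • Pi.single i 1, ?_⟩
          rw [add_mulVec, mulVec_add, mulVec_smul, ← col, vecMulVec_mulVec]
          simp
      · rw [List.map_cons, List.sum_cons, hs, add_comm, add_assoc, z2_add_self, add_zero]
    · push Not at hd
      by_cases h0 : S = 0
      · exact ⟨[], by simp, by simp [h0]⟩
      have : ∃ i j, S i j ≠ 0 := by
        by_contra h
        push Not at h
        exact h0 (by ext i j; exact h i j)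
      obtain ⟨i, j, hij⟩ := this
      have hij1 := z2_ne_zero hij
      obtain ⟨l, hl, hs⟩ := ih (S + (vecMulVec (S i) (S j) + vecMulVec (S j) (S i)))
        (by ext a b; simp [vecMulVec_apply, sy b a]; ring)
        (key _ i (fun h => hij (by rw [h]; rfl))
          (by ext b; simp [vecMulVec_apply, sy j i, hij1, hd, CharTwo.add_self_eq_zero])
          (by intro k hk; ext b; simp [vecMulVec_apply, sy i k, sy j k, hk]))
      refine ⟨S i :: S j :: (S i + S j) :: l, ?_, ?_⟩
      · intro u hu
        simp only [List.mem_cons] at hu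
        rcases hu with rfl | rfl | rfl | hu
        · exact ⟨_, col i⟩
        · exact ⟨_, col j⟩
        · exact ⟨Pi.single i 1 + Pi.single j 1, by rw [mulVec_add, ← col, ← col]⟩
        · obtain ⟨a, rfl⟩ := hl u hu
          refine ⟨a + ((S j ⬝ᵥ a) • Pi.single i 1 + (S i ⬝ᵥ a) • Pi.single j 1), ?_⟩
          rw [add_mulVec, add_mulVec, mulVec_add, mulVec_add, mulVec_smul, mulVec_smul,
            ← col, ← col, vecMulVec_mulVec, vecMulVec_mulVec]
          simp
      · simp only [List.map_cons, List.sum_cons, hs]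
        ext a b
        simp only [Matrix.add_apply, vecMulVec_apply, Pi.add_apply]
        have h2 : (2 : ZMod 2) = 0 := rfl
        linear_combination (S i a * S i b + S j a * S j b + S i a * S j b + S j a * S i b) * h2

lemma T_mul (n : ℕ) (u v : (Fin n ⊕ Fin n) → ZMod 2) (h : sympl n u v = 0) :
    (vecMulVec u u * omegaMat n) * (vecMulVec v v * omegaMat n) = 0 := by
  have : vecMulVec u u * omegaMat n * vecMulVec v v = 0 := by
    rw [Matrix.mul_assoc, Matrix.mul_vecMulVec, Matrix.vecMulVec_mul_vecMulVec]
    unfold sympl at h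
    simp [h]
  rw [← Matrix.mul_assoc, this, Matrix.zero_mul]

lemma prod_T (n : ℕ) (l : List ((Fin n ⊕ Fin n) → ZMod 2))
    (h : ∀ u ∈ l, ∀ v ∈ l, sympl n u v = 0) :
    (l.map (fun u => 1 + vecMulVec u u * omegaMat n)).prod =
      1 + (l.map (fun u => vecMulVec u u)).sum * omegaMat n := by
  induction l with
  | nil => simp
  | cons u l ih =>
    have ih' := ih (fun a ha b hb => h a (by simp [ha]) b (by simp [hb]))
    have hz : ∀ l' : List ((Fin n ⊕ Fin n) → ZMod 2), (∀ v ∈ l', sympl n u v = 0) →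
        (vecMulVec u u * omegaMat n) *
          ((l'.map (fun u => vecMulVec u u)).sum * omegaMat n) = 0 := by
      intro l'
      induction l' with
      | nil => simp
      | cons v l' ih2 =>
        intro hv
        rw [List.map_cons, List.sum_cons, Matrix.add_mul, Matrix.mul_add,
          T_mul n u v (hv v (by simp)), ih2 (fun w hw => hv w (by simp [hw])), add_zero]
    have hz' := hz l (fun v hv => h u (by simp) v (by simp [hv]))
    rw [List.map_cons, List.prod_cons, ih', List.map_cons, List.sum_cons, Matrix.add_mul,
      Matrix.add_mul, Matrix.mul_add (vecMulVec u u * omegaMat n), hz']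
    simp
    abel

/-- Let `C` be binary symplectic with `C² = I` and `N = C + I` over `F₂`.
Then (i) `⟨Nx, Ny⟩ = 0` and `⟨Nx, y⟩ = ⟨x, Ny⟩` for all `x, y`, and (ii) there are vectors
`u₁, …, u_m` with pairwise zero symplectic products such that `N = (Σₖ uₖuₖᵀ)·ω` and
`C = Πₖ (I + uₖuₖᵀω)`, the factors commuting pairwise. -/
theorem symplectic_involution_structure (n : ℕ) (hn : 1 ≤ n)
    (C : Matrix (Fin n ⊕ Fin n) (Fin n ⊕ Fin n) (ZMod 2))
    (hsymp : Cᵀ * omegaMat n * C = omegaMat n) (hC2 : C * C = 1) :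
    (∀ x y : (Fin n ⊕ Fin n) → ZMod 2,
        sympl n ((C + 1).mulVec x) ((C + 1).mulVec y) = 0 ∧
        sympl n ((C + 1).mulVec x) y = sympl n x ((C + 1).mulVec y)) ∧
    ∃ (m : ℕ) (u : Fin m → (Fin n ⊕ Fin n) → ZMod 2),
      (∀ i j, sympl n (u i) (u j) = 0) ∧
      C + 1 = (∑ k, Matrix.vecMulVec (u k) (u k)) * omegaMat n ∧
      C = (List.ofFn
            (fun k : Fin m => 1 + Matrix.vecMulVec (u k) (u k) * omegaMat n)).prod ∧
      (∀ i j,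
        (1 + Matrix.vecMulVec (u i) (u i) * omegaMat n) *
            (1 + Matrix.vecMulVec (u j) (u j) * omegaMat n) =
          (1 + Matrix.vecMulVec (u j) (u j) * omegaMat n) *
            (1 + Matrix.vecMulVec (u i) (u i) * omegaMat n)) := by
  have hw := omega_sq n
  have hwt := omega_tr n
  have h1 : Cᵀ * omegaMat n = omegaMat n * C := by
    calc Cᵀ * omegaMat n = Cᵀ * omegaMat n * (C * C) := by rw [hC2, Matrix.mul_one]
      _ = _ := by rw [← Matrix.mul_assoc, hsymp]
  have hNt : (C + 1)ᵀ * omegaMat n = omegaMat n * (C + 1) := by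
    rw [transpose_add, transpose_one, Matrix.add_mul, Matrix.mul_add, h1]; simp
  have hNN : (C + 1) * (C + 1) = 0 := by
    rw [Matrix.add_mul, Matrix.mul_add, hC2]
    simp only [Matrix.mul_one, Matrix.one_mul]
    rw [add_comm 1 C]
    exact z2_add_self _
  have adj : ∀ x y, sympl n ((C + 1) *ᵥ x) y = sympl n x ((C + 1) *ᵥ y) := by
    intro x y
    unfold sympl
    rw [mulVec_mulVec, ← hNt, ← mulVec_mulVec, dotProduct_mulVec x, vecMul_transpose]
  refine ⟨fun x y => ⟨?_, adj x y⟩, ?_⟩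
  · rw [adj, mulVec_mulVec, hNN]; simp [sympl]
  have hS : ((C + 1) * omegaMat n)ᵀ = (C + 1) * omegaMat n := by
    rw [transpose_mul, hwt]
    calc omegaMat n * (C + 1)ᵀ = omegaMat n * ((C + 1)ᵀ * omegaMat n) * omegaMat n := by
          simp only [Matrix.mul_assoc, hw, Matrix.mul_one]
      _ = _ := by rw [hNt, ← Matrix.mul_assoc, hw, Matrix.one_mul]
  obtain ⟨l, hl, hs⟩ := sym_decomp _ _ hS le_rfl
  have iso : ∀ u ∈ l, ∀ v ∈ l, sympl n u v = 0 := by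
    intro u hu v hv
    obtain ⟨a, rfl⟩ := hl u hu
    obtain ⟨b, rfl⟩ := hl v hv
    rw [← mulVec_mulVec, ← mulVec_mulVec, adj, mulVec_mulVec, hNN]; simp [sympl]
  have isoi : ∀ i j : Fin l.length, sympl n (l.get i) (l.get j) = 0 :=
    fun i j => iso _ (l.get_mem i) _ (l.get_mem j)
  have hprod := prod_T n l iso
  rw [hs, Matrix.mul_assoc, hw, Matrix.mul_one] at hprod
  refine ⟨l.length, l.get, isoi, ?_, ?_, ?_⟩
  · rw [← List.sum_ofFn]
    have : List.ofFn (fun k => vecMulVec (l.get k) (l.get k)) =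
        l.map (fun u => vecMulVec u u) := by
      conv_rhs => rw [← List.ofFn_get l, List.map_ofFn]
      rfl
    rw [this, hs, Matrix.mul_assoc, hw, Matrix.mul_one]
  · have : List.ofFn (fun k => 1 + vecMulVec (l.get k) (l.get k) * omegaMat n) =
        l.map (fun u => 1 + vecMulVec u u * omegaMat n) := by
      conv_rhs => rw [← List.ofFn_get l, List.map_ofFn]
      rfl
    rw [this, hprod, add_comm C 1, ← add_assoc, z2_add_self, zero_add]
  · intro i j
    rw [Matrix.add_mul, Matrix.mul_add, Matrix.mul_add, T_mul n _ _ (isoi i j),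
      Matrix.add_mul, Matrix.mul_add, Matrix.mul_add, T_mul n _ _ (isoi j i)]
    simp only [Matrix.mul_one, Matrix.one_mul, add_zero]
    abel

end
end
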